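/- arXiv:2503.00909 — 5 statements merged into one kernel-verified Lean document; each statement's English description precedes it below -/
import Mathlib

section
/- If G is a q-manifold for some q >= 1, then its soft Barycentric refinement phi(G) is again a q-manifold. -/
open SimpleGraph


/-- Fuel-based definition of Ivashchenko contractibility of a finite simple graph.
The one-point graph is contractible; `G` is contractible if some vertex `v` has
contractible unit sphere `S(v)` and contractible `G \ v`. -/
def ContractibleFuel : ℕ → ∀ {V : Type}, SimpleGraph V → Prop
  | 0, _, _ => False
  | n+1, V, G =>
    (Nonempty V ∧ Subsingleton V) ∨
    ∃ v : V, ContractibleFuel n (G.induce (G.neighborSet v)) ∧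
             ContractibleFuel n (G.induce {w | w ≠ v})

/-- A finite graph is contractible (fuel `Nat.card V` suffices since each
reduction step strictly decreases the number of vertices). -/
def Contractible {V : Type} [Finite V] (G : SimpleGraph V) : Prop :=
  ContractibleFuel (Nat.card V) G

/-- Fuel-based definition of `d`-spheres: the empty graph is the `(-1)`-sphere;
a `d`-sphere is a graph all of whose unit spheres are `(d-1)`-spheres and which
becomes contractible after deleting some vertex. -/
def SphereFuel : ℕ → ℤ → ∀ {V : Type}, SimpleGraph V → Prop
  | 0, d, V, _ => d = -1 ∧ IsEmpty V
  | n+1, d, V, G =>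
    (d = -1 ∧ IsEmpty V) ∨
    ((∀ v : V, SphereFuel n (d-1) (G.induce (G.neighborSet v))) ∧
     ∃ v : V, ContractibleFuel n (G.induce {w | w ≠ v}))

/-- `G` is a `d`-sphere. -/
def IsSphere {V : Type} [Finite V] (d : ℤ) (G : SimpleGraph V) : Prop :=
  SphereFuel (Nat.card V + 1) d G

/-- `G` is a `d`-ball: a `d`-sphere with one vertex deleted. -/
def IsBall {V : Type} (d : ℤ) (G : SimpleGraph V) : Prop :=
  ∃ (W : Type) (hW : Finite W) (H : SimpleGraph W) (v : W),
    @IsSphere W hW d H ∧ Nonempty (G ≃g H.induce {w | w ≠ v})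

/-- `G` is a `q`-manifold: a nonempty graph all of whose unit spheres are `(q-1)`-spheres. -/
def IsGraphManifold {V : Type} [Finite V] (q : ℕ) (G : SimpleGraph V) : Prop :=
  Nonempty V ∧ ∀ v : V, IsSphere ((q : ℤ) - 1) (G.induce (G.neighborSet v))

/-- `G` is a `q`-manifold with boundary: a nonempty graph all of whose unit spheres
are `(q-1)`-spheres or `(q-1)`-balls. -/
def IsManifoldWithBoundary {V : Type} [Finite V] (q : ℕ) (G : SimpleGraph V) : Prop :=
  Nonempty V ∧ ∀ v : V,
    IsSphere ((q : ℤ) - 1) (G.induce (G.neighborSet v)) ∨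
    IsBall ((q : ℤ) - 1) (G.induce (G.neighborSet v))

/-- The boundary of a `q`-manifold with boundary: the set of vertices whose
unit sphere is a `(q-1)`-ball. -/
def boundarySet {V : Type} (q : ℕ) (G : SimpleGraph V) : Set V :=
  {v | IsBall ((q : ℤ) - 1) (G.induce (G.neighborSet v))}

/-- `G` has maximal dimension `q`: its largest cliques have `q+1` vertices. -/
def MaxDim {V : Type} (G : SimpleGraph V) (q : ℕ) : Prop :=
  (∃ s : Finset V, G.IsNClique (q+1) s) ∧
  ∀ s : Finset V, G.IsClique (s : Set V) → s.card ≤ q + 1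

/-- A boundary face of a graph of maximal dimension `q`: a `(q-1)`-simplex
(clique with `q` vertices) contained in exactly one facet. -/
def IsBoundaryFace {V : Type} (G : SimpleGraph V) (q : ℕ) (s : Finset V) : Prop :=
  G.IsNClique q s ∧ {t : Finset V | G.IsNClique (q+1) t ∧ s ⊆ t}.ncard = 1

/-- An interior face: a `(q-1)`-simplex contained in exactly two facets. -/
def IsInteriorFace {V : Type} (G : SimpleGraph V) (q : ℕ) (s : Finset V) : Prop :=
  G.IsNClique q s ∧ {t : Finset V | G.IsNClique (q+1) t ∧ s ⊆ t}.ncard = 2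

/-- Vertices of the soft Barycentric refinement: all simplices of dimension
different from `q-1` (i.e. cliques whose cardinality is not `q`), together with
the boundary faces. -/
def softVerts {V : Type} (G : SimpleGraph V) (q : ℕ) : Set (Finset V) :=
  {s | s.Nonempty ∧ G.IsClique (s : Set V) ∧ (s.card ≠ q ∨ IsBoundaryFace G q s)}

/-- The soft Barycentric refinement `phi(G)` of a graph `G` of maximal dimension `q`:
two vertices are adjacent if one is strictly contained in the other, or if both are
facets whose intersection is an interior face. -/
noncomputable def softBary {V : Type} (G : SimpleGraph V) (q : ℕ) :
    SimpleGraph (softVerts G q) :=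
  letI := Classical.decEq V
  SimpleGraph.fromRel (fun a b =>
    (a : Finset V) ⊂ (b : Finset V) ∨
    (G.IsNClique (q+1) (a : Finset V) ∧ G.IsNClique (q+1) (b : Finset V) ∧
      IsInteriorFace G q ((a : Finset V) ∩ (b : Finset V))))

/-- Vertices of the Barycentric refinement: the nonempty cliques of `G`. -/
def cliqueVerts {V : Type} (G : SimpleGraph V) : Set (Finset V) :=
  {s | s.Nonempty ∧ G.IsClique (s : Set V)}

/-- The Barycentric refinement `psi(G)`: nonempty cliques, two being adjacent
if one is strictly contained in the other. -/
def bary {V : Type} (G : SimpleGraph V) : SimpleGraph (cliqueVerts G) :=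
  SimpleGraph.fromRel (fun a b => (a : Finset V) ⊂ (b : Finset V))

/-- The dual graph of a `q`-manifold: vertices are the facets (cliques with `q+1`
vertices), two facets being adjacent if their intersection has `q` vertices. -/
noncomputable def dualGraph {V : Type} (G : SimpleGraph V) (q : ℕ) :
    SimpleGraph {t : Finset V // G.IsNClique (q+1) t} :=
  letI := Classical.decEq V
  SimpleGraph.fromRel (fun a b => ((a : Finset V) ∩ (b : Finset V)).card = q)

/-- The number of cliques with `k` vertices (i.e. `(k-1)`-simplices) of `G`. -/
noncomputable def fcount {V : Type} (G : SimpleGraph V) (k : ℕ) : ℕ :=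
  Nat.card {s : Finset V // G.IsNClique k s}

/-- The vertex arboricity: the minimal number of parts in a partition of the
vertex set such that each part induces an acyclic subgraph. -/
noncomputable def vertexArboricity {V : Type} (G : SimpleGraph V) : ℕ :=
  sInf {n : ℕ | ∃ f : V → Fin n, ∀ i : Fin n, (G.induce (f ⁻¹' {i})).IsAcyclic}


/-- A real symmetric matrix is Hermitian. -/
theorem Matrix.IsSymm.isHermitianReal {n : ℕ} {A : Matrix (Fin n) (Fin n) ℝ}
    (hA : A.IsSymm) : A.IsHermitian := by
  rw [Matrix.IsHermitian, Matrix.conjTranspose_eq_transpose_of_trivial]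
  exact hA

/-- The eigenvalues of a real Hermitian (= symmetric) matrix, listed with
multiplicity in increasing order. -/
noncomputable def matEigList {n : ℕ} {A : Matrix (Fin n) (Fin n) ℝ}
    (hA : A.IsHermitian) : List ℝ :=
  Multiset.sort (Finset.univ.val.map hA.eigenvalues) (· ≤ ·)

/-- The Kirchhoff Laplacian `L = D - A` of a graph is Hermitian. -/
theorem lapHerm {V : Type} [Fintype V] [DecidableEq V] (G : SimpleGraph V)
    [DecidableRel G.Adj] : (G.lapMatrix ℝ).IsHermitian := by
  rw [Matrix.IsHermitian, Matrix.conjTranspose_eq_transpose_of_trivial]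
  exact G.isSymm_lapMatrix (R := ℝ)

/-- The eigenvalues of the Kirchhoff Laplacian of `G`, listed with multiplicity
in increasing order. -/
noncomputable def eigList {V : Type} [Fintype V] [DecidableEq V] (G : SimpleGraph V)
    [DecidableRel G.Adj] : List ℝ :=
  Multiset.sort (Finset.univ.val.map (lapHerm G).eigenvalues) (· ≤ ·)

/-- The vertex degrees of `G`, listed in increasing order. -/
noncomputable def degList {V : Type} [Fintype V] (G : SimpleGraph V)
    [DecidableRel G.Adj] : List ℕ :=
  Multiset.sort (Finset.univ.val.map (fun v => G.degree v)) (· ≤ ·)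

/-- The graph distance of two graphs on the same vertex set: the number of edges
in the symmetric difference of the edge sets. -/
noncomputable def graphDist {V : Type} [Fintype V] [DecidableEq V]
    (G H : SimpleGraph V) [DecidableRel G.Adj] [DecidableRel H.Adj] : ℕ :=
  (symmDiff G.edgeFinset H.edgeFinset).card

/-- A bundled finite simple graph. -/
structure FinGraph : Type 1 where
  V : Type
  fin : Finite V
  graph : SimpleGraph V

/-- The soft Barycentric refinement as an operation on bundled finite graphs. -/
noncomputable def softStep (q : ℕ) (H : FinGraph) : FinGraph :=
  letI := H.fin
  letI : Fintype H.V := Fintype.ofFinite _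
  { V := softVerts H.graph q
    fin := inferInstance
    graph := softBary H.graph q }

/-- Eigenvalues of the Kirchhoff Laplacian of a bundled finite graph, in
increasing order. -/
noncomputable def gEigList (H : FinGraph) : List ℝ :=
  letI := H.fin
  letI : Fintype H.V := Fintype.ofFinite _
  letI := Classical.decEq H.V
  letI : DecidableRel H.graph.Adj := Classical.decRel _
  eigList H.graph

/-- The spectral function `F_G(x) = lambda_{ceil(n x)}` on `(0,1]`, where
`lambda_1 <= ... <= lambda_n` are the Kirchhoff Laplacian eigenvalues. -/
noncomputable def specFun (H : FinGraph) : ℝ → ℝ :=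
  fun x => (gEigList H).getD (⌈(Nat.card H.V : ℝ) * x⌉₊ - 1) 0

/-- Contractibility of the subgraph of `G` induced by a set of vertices. -/
inductive ContrOn {V : Type*} (G : SimpleGraph V) : Set V → Prop
  | single (v : V) : ContrOn G {v}
  | step {S : Set V} (v : V) (hv : v ∈ S) (hl : ContrOn G (S ∩ G.neighborSet v))
      (hd : ContrOn G (S \ {v})) : ContrOn G S

/-- The subgraph of `G` induced by a set of vertices is a sphere of dimension `d - 1`. -/
def SphOn {V : Type*} (G : SimpleGraph V) : ℕ → Set V → Prop
  | 0, S => S = ∅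
  | d + 1, S => (∀ v ∈ S, SphOn G d (S ∩ G.neighborSet v)) ∧ ∃ v ∈ S, ContrOn G (S \ {v})

section Generalities

variable {V W : Type*} {G : SimpleGraph V} {H : SimpleGraph W}

theorem ContrOn.nonempty {S : Set V} (h : ContrOn G S) : S.Nonempty := by
  cases h with
  | single v => exact ⟨v, rfl⟩
  | step v hv _ _ => exact ⟨v, hv⟩

theorem ContrOn.exists_adj {S : Set V} (h : ContrOn G S) :
    ∀ x ∈ S, ∀ y ∈ S, y ≠ x → ∃ w ∈ S, G.Adj x w := by
  induction h with
  | single v =>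
    rintro x rfl y rfl h
    exact absurd rfl h
  | @step S v hv hl hd _ ih =>
    intro x hx y hy hxy
    obtain ⟨u, hu, hvu⟩ := hl.nonempty
    by_cases hxv : x = v
    · subst hxv
      exact ⟨u, hu, hvu⟩
    by_cases hux : u = x
    · subst hux
      exact ⟨v, hv, hvu.symm⟩
    · obtain ⟨w, hw, h⟩ := ih x ⟨hx, hxv⟩ u ⟨hu, fun h => G.ne_of_adj hvu h.symm⟩ hux
      exact ⟨w, hw.1, h⟩

theorem ContrOn.map {S : Set V} (h : ContrOn G S) (f : V → W) (hf : Set.InjOn f S)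
    (hadj : ∀ x ∈ S, ∀ y ∈ S, G.Adj x y ↔ H.Adj (f x) (f y)) : ContrOn H (f '' S) := by
  induction h with
  | single v => rw [Set.image_singleton]; exact .single _
  | @step S v hv hl hd ihl ihd =>
    refine .step (f v) (Set.mem_image_of_mem f hv) ?_ ?_
    · have : f '' S ∩ H.neighborSet (f v) = f '' (S ∩ G.neighborSet v) := by
        ext w
        constructor
        · rintro ⟨⟨x, hx, rfl⟩, hw⟩
          exact ⟨x, ⟨hx, (hadj v hv x hx).2 hw⟩, rfl⟩
        · rintro ⟨x, ⟨hx, hw⟩, rfl⟩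
          exact ⟨⟨x, hx, rfl⟩, (hadj v hv x hx).1 hw⟩
      rw [this]
      exact ihl (hf.mono Set.inter_subset_left) fun x hx y hy => hadj x hx.1 y hy.1
    · have : f '' S \ {f v} = f '' (S \ {v}) := by
        rw [hf.image_sdiff, Set.inter_eq_right.2 (Set.singleton_subset_iff.2 hv),
          Set.image_singleton]
      rw [this]
      exact ihd (hf.mono Set.sdiff_subset) fun x hx y hy => hadj x hx.1 y hy.1

theorem SphOn.map {d : ℕ} {S : Set V} (h : SphOn G d S) (f : V → W) (hf : Set.InjOn f S)
    (hadj : ∀ x ∈ S, ∀ y ∈ S, G.Adj x y ↔ H.Adj (f x) (f y)) : SphOn H d (f '' S) := by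
  induction d generalizing S with
  | zero =>
    have hS : S = ∅ := h
    subst hS
    exact Set.image_empty f
  | succ d ih =>
    obtain ⟨hl, v, hv, hc⟩ := h
    refine ⟨?_, f v, Set.mem_image_of_mem f hv, ?_⟩
    · rintro _ ⟨v, hv, rfl⟩
      have : f '' S ∩ H.neighborSet (f v) = f '' (S ∩ G.neighborSet v) := by
        ext w
        constructor
        · rintro ⟨⟨x, hx, rfl⟩, hw⟩
          exact ⟨x, ⟨hx, (hadj v hv x hx).2 hw⟩, rfl⟩
        · rintro ⟨x, ⟨hx, hw⟩, rfl⟩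
          exact ⟨⟨x, hx, rfl⟩, (hadj v hv x hx).1 hw⟩
      rw [this]
      exact ih (hl v hv) (hf.mono Set.inter_subset_left) fun x hx y hy => hadj x hx.1 y hy.1
    · have : f '' S \ {f v} = f '' (S \ {v}) := by
        rw [hf.image_sdiff, Set.inter_eq_right.2 (Set.singleton_subset_iff.2 hv),
          Set.image_singleton]
      rw [this]
      exact hc.map f (hf.mono Set.sdiff_subset) fun x hx y hy => hadj x hx.1 y hy.1

theorem SphOn.of_map [Nonempty V] {d : ℕ} {S : Set V} (f : V → W) (h : SphOn H d (f '' S))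
    (hf : Set.InjOn f S) (hadj : ∀ x ∈ S, ∀ y ∈ S, G.Adj x y ↔ H.Adj (f x) (f y)) :
    SphOn G d S := by
  have hinv : Set.LeftInvOn (Function.invFunOn f S) f S := hf.leftInvOn_invFunOn
  have := h.map (H := G) (Function.invFunOn f S) ?_ ?_
  · rwa [hinv.image_image] at this
  · rintro _ ⟨x, hx, rfl⟩ _ ⟨y, hy, rfl⟩ hxy
    rw [hinv hx, hinv hy] at hxy
    rw [hxy]
  · rintro _ ⟨x, hx, rfl⟩ _ ⟨y, hy, rfl⟩
    rw [hinv hx, hinv hy, hadj x hx y hy]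

theorem contrOn_of_apex [Finite V] {S : Set V} {a : V} (ha : a ∈ S)
    (h : ∀ x ∈ S, x ≠ a → G.Adj a x) : ContrOn G S := by
  induction hn : S.ncard using Nat.strong_induction_on generalizing S with
  | _ n ih =>
    subst hn
    by_cases hS : ∃ b ∈ S, b ≠ a
    · obtain ⟨b, hb, hba⟩ := hS
      have hlt : ∀ T : Set V, T ⊆ S → b ∉ T → T.ncard < S.ncard := fun T hT hbT =>
        Set.ncard_lt_ncard (Set.ssubset_iff_subset_ne.2 ⟨hT, fun h => hbT (h ▸ hb)⟩)
          (Set.toFinite S)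
      refine .step b hb (ih _ (hlt _ Set.inter_subset_left fun h => G.irrefl h.2)
        ⟨ha, (h b hb hba).symm⟩ (fun x hx => h x hx.1) rfl) (ih _ (hlt (S \ {b})
        Set.sdiff_subset fun h => h.2 rfl) ⟨ha, hba.symm⟩ (fun x hx => h x hx.1) rfl)
    · push Not at hS
      have : S = {a} := Set.eq_singleton_iff_unique_mem.2 ⟨ha, hS⟩
      rw [this]
      exact .single a

theorem ContrOn.join [Finite V] {A B : Set V} (hA : ContrOn G A)
    (h : ∀ a ∈ A, ∀ b ∈ B, G.Adj a b) : ContrOn G (A ∪ B) := by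
  induction hA with
  | single v =>
    refine contrOn_of_apex (a := v) (.inl rfl) ?_
    rintro x (hx | hx) hxv
    · exact absurd hx hxv
    · exact h v rfl x hx
  | @step A v hv hl hd ihl ihd =>
    refine .step v (.inl hv) ?_ ?_
    · have : (A ∪ B) ∩ G.neighborSet v = A ∩ G.neighborSet v ∪ B := by
        rw [Set.union_inter_distrib_right, Set.inter_eq_left.2 (show B ⊆ G.neighborSet v from fun b hb => h v hv b hb)]
      rw [this]
      exact ihl fun a ha => h a ha.1
    · have : (A ∪ B) \ {v} = A \ {v} ∪ B := by
        rw [Set.union_sdiff_distrib, Set.sdiff_singleton_eq_self (s := B)]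
        exact fun hb => G.irrefl (h v hv v hb)
      rw [this]
      exact ihd fun a ha => h a ha.1

theorem SphOn.join [Finite V] {c d : ℕ} {A B : Set V} (hA : SphOn G c A) (hB : SphOn G d B)
    (h : ∀ a ∈ A, ∀ b ∈ B, G.Adj a b) : SphOn G (c + d) (A ∪ B) := by
  induction hn : c + d generalizing c d A B with
  | zero =>
    obtain ⟨rfl, rfl⟩ : c = 0 ∧ d = 0 := by omega
    have h1 : A = ∅ := hA
    have h2 : B = ∅ := hB
    subst h1 h2
    exact Set.union_empty ∅
  | succ n ih =>
    refine ⟨?_, ?_⟩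
    · rintro v (hv | hv)
      · have : (A ∪ B) ∩ G.neighborSet v = A ∩ G.neighborSet v ∪ B := by
          rw [Set.union_inter_distrib_right, Set.inter_eq_left.2 (show B ⊆ G.neighborSet v from fun b hb => h v hv b hb)]
        rw [this]
        cases c with
        | zero => exact absurd hv (by rw [show A = ∅ from hA]; exact id)
        | succ c => exact ih (hA.1 v hv) hB (fun a ha => h a ha.1) (by omega)
      · have : (A ∪ B) ∩ G.neighborSet v = A ∪ B ∩ G.neighborSet v := by
          rw [Set.union_inter_distrib_right,
            Set.inter_eq_left.2 (show A ⊆ G.neighborSet v from fun a ha => (h a ha v hv).symm)]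
        rw [this]
        cases d with
        | zero => exact absurd hv (by rw [show B = ∅ from hB]; exact id)
        | succ d => exact ih hA (hB.1 v hv) (fun a ha b hb => h a ha b hb.1) (by omega)
    · cases c with
      | succ c =>
        obtain ⟨_, v, hv, hc⟩ := hA
        refine ⟨v, .inl hv, ?_⟩
        have : (A ∪ B) \ {v} = A \ {v} ∪ B := by
          rw [Set.union_sdiff_distrib, Set.sdiff_singleton_eq_self (s := B)]
          exact fun hb => G.irrefl (h v hv v hb)
        rw [this]
        exact hc.join fun a ha => h a ha.1
      | zero =>
        have hA' : A = ∅ := hA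
        subst hA'
        rw [Set.empty_union]
        cases d with
        | zero => omega
        | succ d => exact hB.2

/-- Vertices can be added in decreasing order of rank as long as the links are contractible. -/
theorem ContrOn.union_of_links [Finite V] {X R : Set V} (rank : V → ℕ) (hX : ContrOn G X)
    (hXR : Disjoint X R)
    (h : ∀ p ∈ R, ∀ Q ⊆ R, p ∉ Q → (∀ q ∈ Q, rank p ≤ rank q) →
      ContrOn G ((X ∪ Q) ∩ G.neighborSet p)) : ContrOn G (X ∪ R) := by
  induction hn : R.ncard generalizing R with
  | zero =>
    rw [Set.ncard_eq_zero] at hn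
    rwa [hn, Set.union_empty]
  | succ n ih =>
    have hne : R.Nonempty := (Set.ncard_pos (Set.toFinite R)).1 (by omega)
    obtain ⟨p, hp, hmin⟩ := Set.exists_min_image R rank (Set.toFinite R) hne
    have hpX : p ∉ X := fun hpX => Set.disjoint_left.1 hXR hpX hp
    have e1 : (X ∪ R) \ {p} = X ∪ (R \ {p}) := by
      rw [Set.union_sdiff_distrib, Set.sdiff_singleton_eq_self hpX]
    have e2 : (X ∪ R) ∩ G.neighborSet p = (X ∪ (R \ {p})) ∩ G.neighborSet p := by
      rw [← e1]
      ext x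
      constructor
      · rintro ⟨hx, hpx⟩
        exact ⟨⟨hx, fun h => G.ne_of_adj hpx h.symm⟩, hpx⟩
      · rintro ⟨hx, hpx⟩
        exact ⟨hx.1, hpx⟩
    refine .step p (.inr hp) ?_ ?_
    · rw [e2]
      exact h p hp _ Set.sdiff_subset (fun h => h.2 rfl) fun q hq => hmin q hq.1
    · rw [e1]
      refine ih (hXR.mono_right Set.sdiff_subset) (fun r hr Q hQ => h r hr.1 Q
        (hQ.trans Set.sdiff_subset)) ?_
      have := Set.ncard_sdiff_singleton_add_one hp (Set.toFinite R)
      omega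

theorem SphOn.eq_pair {S : Set V} (h : SphOn G 1 S) :
    ∃ a b, a ≠ b ∧ ¬ G.Adj a b ∧ S = {a, b} := by
  obtain ⟨hl, v, hv, hc⟩ := h
  have hno : ∀ x ∈ S, ∀ y ∈ S, ¬ G.Adj x y := fun x hx y hy hxy => by
    have : S ∩ G.neighborSet x = ∅ := hl x hx
    exact (this ▸ ⟨hy, hxy⟩ : y ∈ (∅ : Set V))
  obtain ⟨u, hu⟩ := hc.nonempty
  refine ⟨v, u, fun h => hu.2 h.symm, hno v hv u hu.1, ?_⟩
  ext x
  constructor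
  · intro hx
    by_contra hx'
    simp only [Set.mem_insert_iff, Set.mem_singleton_iff, not_or] at hx'
    obtain ⟨w, hw, hxw⟩ := hc.exists_adj x ⟨hx, hx'.1⟩ u hu (Ne.symm hx'.2)
    exact hno x hx w hw.1 hxw
  · rintro (rfl | rfl)
    exacts [hv, hu.1]

end Generalities

section Fuel

variable {U : Type*} {G : SimpleGraph U}

theorem range_induce_neighborSet {W : Type*} {H : SimpleGraph W} (f : H ↪g G) (v : W) :
    Set.range (f.comp (SimpleGraph.Embedding.induce (G := H) (H.neighborSet v))) =
      Set.range f ∩ G.neighborSet (f v) := by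
  ext x
  constructor
  · rintro ⟨⟨w, hw⟩, rfl⟩
    exact ⟨⟨w, rfl⟩, f.map_adj_iff.2 hw⟩
  · rintro ⟨⟨w, rfl⟩, hw⟩
    exact ⟨⟨w, f.map_adj_iff.1 hw⟩, rfl⟩

theorem range_induce_ne {W : Type*} {H : SimpleGraph W} (f : H ↪g G) (v : W) :
    Set.range (f.comp (SimpleGraph.Embedding.induce (G := H) {w | w ≠ v})) =
      Set.range f \ {f v} := by
  ext x
  constructor
  · rintro ⟨⟨w, hw⟩, rfl⟩
    exact ⟨⟨w, rfl⟩, fun h => hw (f.injective h)⟩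
  · rintro ⟨⟨w, rfl⟩, hw⟩
    exact ⟨⟨w, fun h => hw (congrArg f h)⟩, rfl⟩

theorem ContractibleFuel.contrOn (n : ℕ) {W : Type} {H : SimpleGraph W} (f : H ↪g G)
    (h : ContractibleFuel n H) : ContrOn G (Set.range f) := by
  induction n generalizing W with
  | zero => exact h.elim
  | succ n ih =>
    obtain ⟨⟨w⟩, hs⟩ | ⟨v, hl, hd⟩ := h
    · have : Set.range f = {f w} := by
        ext x
        constructor
        · rintro ⟨y, rfl⟩
          rw [Subsingleton.elim y w]
          rfl
        · rintro rfl
          exact ⟨w, rfl⟩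
      rw [this]
      exact .single _
    · refine .step (f v) ⟨v, rfl⟩ ?_ ?_
      · rw [← range_induce_neighborSet]
        exact ih _ hl
      · rw [← range_induce_ne]
        exact ih _ hd

theorem card_subtype_lt {W : Type*} [Finite W] {v : W} {s : Set W} (hv : v ∉ s) :
    Nat.card s < Nat.card W := by
  rw [Nat.card_coe_set_eq, ← Set.ncard_univ]
  exact Set.ncard_lt_ncard (Set.ssubset_univ_iff.2 fun h => hv (h ▸ Set.mem_univ v))
    (Set.toFinite _)

theorem ContrOn.contractibleFuel {S : Set U} (h : ContrOn G S) {W : Type} [Finite W]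
    {H : SimpleGraph W} (f : H ↪g G) (hf : Set.range f = S) (n : ℕ) (hn : Nat.card W ≤ n) :
    ContractibleFuel n H := by
  induction h generalizing W n with
  | single v =>
    obtain ⟨w, -⟩ : v ∈ Set.range f := hf ▸ rfl
    have : Nonempty W := ⟨w⟩
    have hpos := Nat.card_pos (α := W)
    obtain ⟨n, rfl⟩ : ∃ k, n = k + 1 := ⟨n - 1, by omega⟩
    refine .inl ⟨this, ⟨fun x y => f.injective ?_⟩⟩
    have hx : f x ∈ ({v} : Set U) := hf ▸ ⟨x, rfl⟩
    have hy : f y ∈ ({v} : Set U) := hf ▸ ⟨y, rfl⟩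
    exact hx.trans hy.symm
  | @step S v hv hl hd ihl ihd =>
    subst hf
    obtain ⟨v, rfl⟩ := hv
    have : Nonempty W := ⟨v⟩
    have hpos := Nat.card_pos (α := W)
    obtain ⟨n, rfl⟩ : ∃ k, n = k + 1 := ⟨n - 1, by omega⟩
    refine .inr ⟨v, ihl _ (range_induce_neighborSet f v) n ?_, ihd _ (range_induce_ne f v) n ?_⟩
    · have := card_subtype_lt (v := v) (s := H.neighborSet v) (fun h => H.irrefl h)
      omega
    · have := card_subtype_lt (v := v) (s := {w | w ≠ v}) (fun h => h rfl)
      omega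

theorem not_sphereFuel_of_lt (n : ℕ) {e : ℤ} (he : e < -1) {W : Type} {H : SimpleGraph W} :
    ¬ SphereFuel n e H := by
  induction n generalizing e W with
  | zero => exact fun h => by have := h.1; omega
  | succ n ih =>
    rintro (h | ⟨h, v, -⟩)
    · have := h.1
      omega
    · exact ih (by omega) (h v)

theorem SphereFuel.sphOn (n d : ℕ) {W : Type} {H : SimpleGraph W} (f : H ↪g G)
    (h : SphereFuel n ((d : ℤ) - 1) H) : SphOn G d (Set.range f) := by
  induction n generalizing d W with
  | zero =>
    obtain ⟨hd, _⟩ := h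
    obtain rfl : d = 0 := by omega
    exact Set.range_eq_empty _
  | succ n ih =>
    obtain ⟨hd, _⟩ | ⟨hl, v, hc⟩ := h
    · obtain rfl : d = 0 := by omega
      exact Set.range_eq_empty _
    · cases d with
      | zero => exact (not_sphereFuel_of_lt n (by simp) (hl v)).elim
      | succ d =>
        refine ⟨?_, f v, ⟨v, rfl⟩, ?_⟩
        · rintro _ ⟨v, rfl⟩
          rw [← range_induce_neighborSet]
          refine ih d _ ?_
          have := hl v
          rwa [show ((d + 1 : ℕ) : ℤ) - 1 - 1 = (d : ℤ) - 1 by push_cast; ring] at this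
        · rw [← range_induce_ne]
          exact ContractibleFuel.contrOn n (f.comp (SimpleGraph.Embedding.induce (G := H) {w | w ≠ v})) hc

theorem SphOn.sphereFuel (d : ℕ) {W : Type} [Finite W] {H : SimpleGraph W} (f : H ↪g G)
    (h : SphOn G d (Set.range f)) (n : ℕ) (hn : Nat.card W ≤ n) :
    SphereFuel (n + 1) ((d : ℤ) - 1) H := by
  induction d generalizing W n with
  | zero => exact .inl ⟨by simp, Set.range_eq_empty_iff.1 h⟩
  | succ d ih =>
    obtain ⟨hl, _, ⟨v, rfl⟩, hc⟩ := h
    refine .inr ⟨fun v => ?_, v, ?_⟩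
    · have : Nonempty W := ⟨v⟩
      have hpos := Nat.card_pos (α := W)
      obtain ⟨n, rfl⟩ : ∃ k, n = k + 1 := ⟨n - 1, by omega⟩
      have := card_subtype_lt (v := v) (s := H.neighborSet v) (fun h => H.irrefl h)
      rw [show ((d + 1 : ℕ) : ℤ) - 1 - 1 = (d : ℤ) - 1 by push_cast; ring]
      refine ih (f.comp (SimpleGraph.Embedding.induce (G := H) (H.neighborSet v))) ?_ n (by omega)
      rw [range_induce_neighborSet]
      exact hl _ ⟨v, rfl⟩
    · have := card_subtype_lt (v := v) (s := {w | w ≠ v}) (fun h => h rfl)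
      exact hc.contractibleFuel _ (range_induce_ne f v) n (by omega)

theorem isSphere_iff_sphOn (d : ℕ) {W : Type} [Finite W] {H : SimpleGraph W} (f : H ↪g G) :
    IsSphere ((d : ℤ) - 1) H ↔ SphOn G d (Set.range f) :=
  ⟨fun h => SphereFuel.sphOn _ d f h, fun h => SphOn.sphereFuel d f h _ le_rfl⟩

end Fuel

section SoftSimplices

variable {V : Type*} [DecidableEq V] {G : SimpleGraph V}

/-- The graph of finite sets in which two sets are adjacent if one strictly contains the other,
or if both have `m + 1` elements of which exactly `m` are shared. -/
def softGraph (V : Type*) [DecidableEq V] (m : ℕ) : SimpleGraph (Finset V) where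
  Adj a b := a ⊂ b ∨ b ⊂ a ∨ (a ≠ b ∧ a.card = m + 1 ∧ b.card = m + 1 ∧ (a ∩ b).card = m)
  symm := ⟨fun a b h => by
    rcases h with h | h | ⟨h1, h2, h3, h4⟩
    · exact .inr (.inl h)
    · exact .inl h
    · exact .inr (.inr ⟨h1.symm, h3, h2, Finset.inter_comm a b ▸ h4⟩)⟩
  loopless := ⟨fun a h => by
    rcases h with h | h | h
    · exact h.ne rfl
    · exact h.ne rfl
    · exact h.1 rfl⟩

theorem softGraph_adj {m : ℕ} {a b : Finset V} : (softGraph V m).Adj a b ↔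
    a ⊂ b ∨ b ⊂ a ∨ (a ≠ b ∧ a.card = m + 1 ∧ b.card = m + 1 ∧ (a ∩ b).card = m) := Iff.rfl

theorem softGraph_union_adj {k m : ℕ} {z a b : Finset V} (ha : Disjoint z a) (hb : Disjoint z b)
    (hm : m = k + z.card) : (softGraph V k).Adj a b ↔ (softGraph V m).Adj (z ∪ a) (z ∪ b) := by
  subst hm
  have key : ∀ {a b : Finset V}, Disjoint z a → Disjoint z b → (z ∪ a ⊆ z ∪ b ↔ a ⊆ b) := by
    intro a b ha hb
    constructor
    · intro h x hx
      rcases Finset.mem_union.1 (h (Finset.mem_union_right z hx)) with h' | h'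
      · exact (Finset.disjoint_left.1 ha h' hx).elim
      · exact h'
    · exact Finset.union_subset_union_right
  have hi : Disjoint z (a ∩ b) := ha.mono_right Finset.inter_subset_left
  simp only [softGraph_adj, Finset.ssubset_def, key ha hb, key hb ha, ne_eq,
    Finset.Subset.antisymm_iff, ← Finset.union_inter_distrib_left,
    Finset.card_union_of_disjoint ha, Finset.card_union_of_disjoint hb,
    Finset.card_union_of_disjoint hi]
  have e1 : ∀ n : ℕ, z.card + n = k + z.card + 1 ↔ n = k + 1 := by intro n; omega
  have e2 : ∀ n : ℕ, z.card + n = k + z.card ↔ n = k := by intro n; omega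
  simp only [e1, e2]

/-- The common neighbours in `S` of the vertices of `z`. -/
def commonLink (G : SimpleGraph V) (S : Set V) (z : Finset V) : Set V :=
  {u | u ∈ S ∧ ∀ x ∈ z, G.Adj x u}

/-- The subgraph of `G` induced by `S` has `(m - 1)`-spheres as unit spheres. -/
def MfdOn (G : SimpleGraph V) (m : ℕ) (S : Set V) : Prop :=
  ∀ v ∈ S, SphOn G m (S ∩ G.neighborSet v)

theorem commonLink_insert (S : Set V) (v : V) (z : Finset V) :
    commonLink G S (insert v z) = commonLink G (S ∩ G.neighborSet v) z := by
  ext u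
  simp only [commonLink, Set.mem_ofPred_eq, Finset.mem_insert, forall_eq_or_imp, Set.mem_inter_iff,
    SimpleGraph.mem_neighborSet, and_assoc]

theorem SphOn.link {d : ℕ} {S : Set V} (h : SphOn G d S) {z : Finset V} (hz : G.IsClique z)
    (hzS : ↑z ⊆ S) : ∃ k, k + z.card = d ∧ SphOn G k (commonLink G S z) := by
  induction z using Finset.induction_on generalizing d S with
  | empty =>
    refine ⟨d, by simp, ?_⟩
    have : commonLink G S ∅ = S := by ext; simp [commonLink]
    rwa [this]
  | insert v z hv ih =>
    have hvS : v ∈ S := hzS (by simp)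
    cases d with
    | zero => exact absurd hvS (by rw [show S = ∅ from h]; exact id)
    | succ d =>
      obtain ⟨k, hk, hs⟩ := ih (h.1 v hvS) (hz.subset (by simp)) (fun x hx =>
        ⟨hzS (by simp [Finset.mem_coe.1 hx]), hz (by simp) (by simp [Finset.mem_coe.1 hx])
          (by rintro rfl; exact hv hx)⟩)
      refine ⟨k, by rw [Finset.card_insert_of_notMem hv]; omega, ?_⟩
      rwa [commonLink_insert]

theorem MfdOn.link {m : ℕ} {S : Set V} (h : MfdOn G m S) {z : Finset V} (hz : G.IsClique z)
    (hzS : ↑z ⊆ S) (hne : z.Nonempty) :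
    ∃ k, k + z.card = m + 1 ∧ SphOn G k (commonLink G S z) := by
  obtain ⟨v, hv⟩ := hne
  obtain ⟨y, hvy, rfl⟩ : ∃ y, v ∉ y ∧ insert v y = z :=
    ⟨z.erase v, Finset.notMem_erase v z, Finset.insert_erase hv⟩
  obtain ⟨k, hk, hs⟩ := (h v (hzS hv)).link (hz.subset (by simp) : G.IsClique (y : Set V))
    (fun x hx => ⟨hzS (by simp [Finset.mem_coe.1 hx]), hz (by simp)
      (by simp [Finset.mem_coe.1 hx]) (by rintro rfl; exact hvy hx)⟩)
  refine ⟨k, by rw [Finset.card_insert_of_notMem hvy]; omega, ?_⟩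
  rwa [commonLink_insert]

theorem MfdOn.card_le {m : ℕ} {S : Set V} (h : MfdOn G m S) {z : Finset V} (hz : G.IsClique z)
    (hzS : ↑z ⊆ S) : z.card ≤ m + 1 := by
  rcases z.eq_empty_or_nonempty with rfl | hne
  · simp
  · obtain ⟨k, hk, -⟩ := h.link hz hzS hne
    omega

theorem MfdOn.link_pair {m : ℕ} {S : Set V} (h : MfdOn G m S) (hm : 1 ≤ m) {z : Finset V}
    (hz : G.IsClique z) (hzS : ↑z ⊆ S) (hc : z.card = m) :
    ∃ a b, a ≠ b ∧ ¬ G.Adj a b ∧ commonLink G S z = {a, b} := by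
  obtain ⟨k, hk, hs⟩ := h.link hz hzS (Finset.card_pos.1 (by omega))
  obtain rfl : k = 1 := by omega
  exact hs.eq_pair

omit [DecidableEq V] in
theorem notMem_of_mem_commonLink {S : Set V} {z : Finset V} {u : V} (h : u ∈ commonLink G S z) :
    u ∉ z := fun hu => G.irrefl (h.2 u hu)

theorem isClique_insert_of_mem_commonLink {S : Set V} {z : Finset V} {u : V}
    (hz : G.IsClique z) (h : u ∈ commonLink G S z) : G.IsClique (insert u z : Finset V) := by
  rw [Finset.coe_insert, SimpleGraph.isClique_insert]
  exact ⟨hz, fun x hx _ => (h.2 x hx).symm⟩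

theorem exists_insert_of_card {S : Set V} {F t : Finset V} (ht : G.IsClique t) (htS : ↑t ⊆ S)
    (hF : F ⊆ t) (hc : t.card = F.card + 1) :
    ∃ c, c ∈ commonLink G S F ∧ c ∉ F ∧ t = insert c F := by
  obtain ⟨c, hcF, rfl⟩ := Finset.exists_eq_insert_iff.2 ⟨hF, hc.symm⟩
  refine ⟨c, ⟨htS (by simp), fun x hx => ht (by simp [hx]) (by simp) ?_⟩, hcF, rfl⟩
  rintro rfl
  exact hcF hx

theorem MfdOn.facet_unique {m : ℕ} {S : Set V} (h : MfdOn G m S) (hm : 1 ≤ m)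
    {F t q r : Finset V} (hF : F.card = m)
    (ht : G.IsClique t) (htS : ↑t ⊆ S) (htc : t.card = m + 1) (hFt : F ⊆ t)
    (hq : G.IsClique q) (hqS : ↑q ⊆ S) (hqc : q.card = m + 1) (hFq : F ⊆ q)
    (hr : G.IsClique r) (hrS : ↑r ⊆ S) (hrc : r.card = m + 1) (hFr : F ⊆ r)
    (htq : q ≠ t) (htr : r ≠ t) : q = r := by
  obtain ⟨a, b, -, -, hab⟩ := h.link_pair hm (ht.subset hFt : G.IsClique (F : Set V))
    ((Finset.coe_subset.2 hFt).trans htS) hF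
  obtain ⟨x, hx, -, rfl⟩ := exists_insert_of_card ht htS hFt (by omega)
  obtain ⟨y, hy, -, rfl⟩ := exists_insert_of_card hq hqS hFq (by omega)
  obtain ⟨z, hz, -, rfl⟩ := exists_insert_of_card hr hrS hFr (by omega)
  rw [hab] at hx hy hz
  simp only [Set.mem_insert_iff, Set.mem_singleton_iff] at hx hy hz
  rcases hx with rfl | rfl <;> rcases hy with rfl | rfl <;> rcases hz with rfl | rfl <;> simp_all

theorem MfdOn.exists_opposite {m : ℕ} {S : Set V} (h : MfdOn G m S) (hm : 1 ≤ m)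
    {F t : Finset V} (hF : F.card = m) (ht : G.IsClique t) (htS : ↑t ⊆ S) (htc : t.card = m + 1)
    (hFt : F ⊆ t) : ∃ q : Finset V, G.IsClique q ∧ ↑q ⊆ S ∧ q.card = m + 1 ∧ q ∩ t = F := by
  have hFc : G.IsClique (F : Set V) := ht.subset hFt
  have hFS := (Finset.coe_subset.2 hFt).trans htS
  obtain ⟨a, b, hne, -, hab⟩ := h.link_pair hm hFc hFS hF
  obtain ⟨x, hx, hxF, rfl⟩ := exists_insert_of_card ht htS hFt (by omega)
  obtain ⟨y, hy, hyx⟩ : ∃ y ∈ commonLink G S F, y ≠ x := by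
    by_cases hxa : x = a
    · exact ⟨b, by simp [hab], by rw [hxa]; exact hne.symm⟩
    · exact ⟨a, by simp [hab], Ne.symm hxa⟩
  have hyF := notMem_of_mem_commonLink hy
  refine ⟨insert y F, isClique_insert_of_mem_commonLink hFc hy, ?_, ?_, ?_⟩
  · rw [Finset.coe_insert]
    exact Set.insert_subset hy.1 hFS
  · rw [Finset.card_insert_of_notMem hyF, hF]
  · ext u
    simp only [Finset.mem_inter, Finset.mem_insert]
    constructor
    · rintro ⟨rfl | hu, rfl | hu'⟩
      exacts [(hyx rfl).elim, hu', hu, hu]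
    · exact fun hu => ⟨.inr hu, .inr hu⟩

theorem MfdOn.not_adj_of_adj_facet {m : ℕ} {S : Set V} (h : MfdOn G m S) (hm : 1 ≤ m)
    {t q r : Finset V}
    (ht : G.IsClique t) (htS : ↑t ⊆ S) (htc : t.card = m + 1)
    (hq : G.IsClique q) (hqS : ↑q ⊆ S) (hqc : q.card = m + 1) (htq : (q ∩ t).card = m)
    (hr : G.IsClique r) (hrS : ↑r ⊆ S) (hrc : r.card = m + 1) (htr : (r ∩ t).card = m)
    (hqr : q ≠ r) : (q ∩ r).card ≠ m := by
  have hqt : q ≠ t := by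
    rintro rfl
    rw [Finset.inter_self] at htq
    omega
  have hrt : r ≠ t := by
    rintro rfl
    rw [Finset.inter_self] at htr
    omega
  have hFF : q ∩ t ≠ r ∩ t := fun e => hqr <| h.facet_unique hm htq ht htS htc
    Finset.inter_subset_right hq hqS hqc Finset.inter_subset_left hr hrS hrc
    (e ▸ Finset.inter_subset_left) hqt hrt
  obtain ⟨a, haq, hat⟩ : ∃ a ∈ q, a ∉ t := by
    by_contra! hcon
    exact hqt (Finset.eq_of_subset_of_card_le hcon (by omega))
  have hqa : ∀ x ∈ q, x = a ∨ x ∈ t := by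
    intro x hx
    by_contra! hcon
    have : insert x (insert a (q ∩ t)) ⊆ q := by
      intro y
      simp only [Finset.mem_insert, Finset.mem_inter]
      rintro (rfl | rfl | hy)
      exacts [hx, haq, hy.1]
    have := Finset.card_le_card this
    rw [Finset.card_insert_of_notMem (by simp [hcon]), Finset.card_insert_of_notMem (by simp [hat])]
      at this
    omega
  have hlt : ((q ∩ t) ∩ (r ∩ t)).card < m := by
    rw [← htq]
    refine Finset.card_lt_card (Finset.ssubset_iff_subset_ne.2 ⟨Finset.inter_subset_left, fun e => ?_⟩)
    exact hFF (Finset.eq_of_subset_of_card_le (Finset.inter_eq_left.1 e) (by omega))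
  by_cases har : a ∈ r
  · exfalso
    have hun : (q ∩ t) ∪ (r ∩ t) = t := by
      refine Finset.eq_of_subset_of_card_le (Finset.union_subset Finset.inter_subset_right
        Finset.inter_subset_right) ?_
      have := Finset.card_union_add_card_inter (q ∩ t) (r ∩ t)
      omega
    have hat' : a ∈ commonLink G S t := by
      refine ⟨hqS haq, fun x hx => ?_⟩
      have hxa : x ≠ a := fun e => hat (e ▸ hx)
      rw [← hun] at hx
      rcases Finset.mem_union.1 hx with hx | hx
      · exact hq (Finset.mem_inter.1 hx).1 haq hxa
      · exact hr (Finset.mem_inter.1 hx).1 har hxa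
    have := h.card_le (isClique_insert_of_mem_commonLink ht hat') (by
      rw [Finset.coe_insert]
      exact Set.insert_subset hat'.1 htS)
    rw [Finset.card_insert_of_notMem hat] at this
    omega
  · refine (lt_of_le_of_lt (Finset.card_le_card fun x hx => ?_) hlt).ne
    obtain ⟨hxq, hxr⟩ := Finset.mem_inter.1 hx
    rcases hqa x hxq with rfl | hxt
    · exact (har hxr).elim
    · simp [hxq, hxr, hxt]

end SoftSimplices

section SoftContractible

variable {V : Type*} [DecidableEq V] {G : SimpleGraph V}

theorem ContrOn.union_star [Finite V] {m : ℕ} {X R : Set (Finset V)} (v : V)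
    (hX : ContrOn (softGraph V m) X) (hXv : ∀ q ∈ X, v ∈ q → m < q.card)
    (hR : ∀ p ∈ R, v ∈ p ∧ p.card ≤ m ∧ p.erase v ∈ X) :
    ContrOn (softGraph V m) (X ∪ R) := by
  have hdisj : Disjoint X R := Set.disjoint_left.2 fun p hpX hpR =>
    absurd (hXv p hpX (hR p hpR).1) (not_lt.2 (hR p hpR).2.1)
  refine hX.union_of_links Finset.card hdisj fun p hp Q hQ hpQ hcard => ?_
  obtain ⟨hv, hpc, he⟩ := hR p hp
  have hlt : p.erase v ⊂ p := Finset.erase_ssubset hv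
  have hcard' : ∀ q ∈ X ∪ Q, v ∈ q → p.card ≤ q.card := by
    rintro q (hq | hq) hvq
    · exact hpc.trans (hXv q hq hvq).le
    · exact hcard q hq
  refine contrOn_of_apex (a := p.erase v) ⟨.inl he, .inr (.inl hlt)⟩ ?_
  rintro q ⟨hq, hpq⟩ hne
  rcases hpq with hpq | hpq | hpq
  · exact .inl (hlt.trans hpq)
  · have hvq : v ∉ q := fun hvq =>
      absurd (Finset.card_lt_card hpq) (not_lt.2 (hcard' q hq hvq))
    exact .inr (.inl (Finset.ssubset_iff_subset_ne.2 ⟨Finset.subset_erase.2 ⟨hpq.1, hvq⟩, hne⟩))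
  · have := hpq.2.1
    omega

theorem sphOn_boundary [Finite V] {m d : ℕ} {z : Finset V} (hz : z.card = d + 1) (hd : d ≤ m) :
    SphOn (softGraph V m) d {x | x.Nonempty ∧ x ⊂ z} := by
  induction d using Nat.strong_induction_on generalizing m z with
  | _ d ih =>
  have hlt : ∀ x : Finset V, x ⊂ z → x.card ≤ d := fun x hx => by
    have := Finset.card_lt_card hx
    omega
  cases d with
  | zero =>
    refine Set.eq_empty_of_forall_notMem fun x hx => ?_
    have := hlt x hx.2
    have := Finset.card_pos.2 hx.1
    omega
  | succ d =>
    refine ⟨?_, ?_⟩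
    · rintro x ⟨hx, hxz⟩
      have hxc := hlt x hxz
      have hpos := Finset.card_pos.2 hx
      have hlow : SphOn (softGraph V m) (x.card - 1) {y | y.Nonempty ∧ y ⊂ x} :=
        ih (x.card - 1) (by omega) (by omega) (by omega)
      have hc : (z \ x).card = (d + 1 - x.card) + 1 := by
        rw [Finset.card_sdiff_of_subset hxz.1]
        omega
      have hup₀ : SphOn (softGraph V (m - x.card)) (d + 1 - x.card)
          {y | y.Nonempty ∧ y ⊂ z \ x} := ih (d + 1 - x.card) (by omega) hc (by omega)
      have hup := hup₀.map
        (H := softGraph V m) (x ∪ ·) ?_ ?_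
      · have := hlow.join hup ?_
        · rw [show x.card - 1 + (d + 1 - x.card) = d by omega] at this
          convert this using 1
          ext y
          constructor
          · rintro ⟨⟨hy, hyz⟩, hxy⟩
            rcases hxy with hxy | hxy | hxy
            · refine .inr ⟨y \ x, ⟨Finset.sdiff_nonempty.2 hxy.2, ?_⟩,
                Finset.union_sdiff_of_subset hxy.1⟩
              refine Finset.ssubset_def.2 ⟨Finset.sdiff_subset_sdiff hyz.1 le_rfl, fun h => ?_⟩
              refine hyz.2 fun u hu => ?_
              by_cases hux : u ∈ x
              · exact hxy.1 hux
              · exact (Finset.mem_sdiff.1 (h (Finset.mem_sdiff.2 ⟨hu, hux⟩))).1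
            · exact .inl ⟨hy, hxy⟩
            · have := hlt y hyz
              have := hxy.2.2.1
              have := hxy.2.1
              omega
          · rintro (⟨hy, hyx⟩ | ⟨u, ⟨⟨w, hw⟩, huz⟩, rfl⟩)
            · exact ⟨⟨hy, hyx.trans hxz⟩, .inr (.inl hyx)⟩
            · refine ⟨⟨hx.mono Finset.subset_union_left, ?_⟩, .inl ?_⟩
              · refine Finset.ssubset_def.2 ⟨Finset.union_subset hxz.1
                  (huz.1.trans Finset.sdiff_subset), fun h => huz.2 fun y hy => ?_⟩
                obtain ⟨hyz, hyx⟩ := Finset.mem_sdiff.1 hy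
                exact (Finset.mem_union.1 (h hyz)).resolve_left hyx
              · refine Finset.ssubset_def.2 ⟨Finset.subset_union_left, fun h => ?_⟩
                exact (Finset.mem_sdiff.1 (huz.1 hw)).2 (h (Finset.mem_union_right x hw))
        · rintro a ⟨-, ha⟩ _ ⟨u, -, rfl⟩
          exact .inl (ha.trans_subset Finset.subset_union_left)
      · intro a ha b hb hab
        have ha' : Disjoint x a := (Finset.disjoint_sdiff).mono_right ha.2.1
        have hb' : Disjoint x b := (Finset.disjoint_sdiff).mono_right hb.2.1
        have := congrArg (· \ x) hab
        simpa only [Finset.union_sdiff_cancel_left ha', Finset.union_sdiff_cancel_left hb']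
          using this
      · intro a ha b hb
        exact softGraph_union_adj ((Finset.disjoint_sdiff).mono_right ha.2.1)
          ((Finset.disjoint_sdiff).mono_right hb.2.1) (by omega)
    · obtain ⟨v, hv⟩ : z.Nonempty := Finset.card_pos.1 (by omega)
      have hvz : ({v} : Finset V) ⊂ z := by
        refine Finset.ssubset_iff_subset_ne.2 ⟨by simpa using hv, fun h => ?_⟩
        rw [← h, Finset.card_singleton] at hz
        omega
      refine ⟨{v}, ⟨by simp, hvz⟩, ?_⟩
      have hX : ContrOn (softGraph V m) {x : Finset V | x.Nonempty ∧ x ⊆ z.erase v} := by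
        refine contrOn_of_apex (a := z.erase v) ⟨?_, le_rfl⟩ fun x hx hne =>
          .inr (.inl (Finset.ssubset_iff_subset_ne.2 ⟨hx.2, hne⟩))
        rw [← Finset.card_pos, Finset.card_erase_of_mem hv]
        omega
      have := hX.union_star (R := {x | v ∈ x ∧ x ≠ {v} ∧ x ⊂ z}) v ?_ ?_
      · convert this using 1
        ext x
        simp only [Set.mem_sdiff, Set.mem_ofPred_eq, Set.mem_singleton_iff, Set.mem_union,
          Finset.subset_erase]
        constructor
        · rintro ⟨⟨hx, hxz⟩, hxv⟩
          by_cases hvx : v ∈ x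
          · exact .inr ⟨hvx, hxv, hxz⟩
          · exact .inl ⟨hx, hxz.1, hvx⟩
        · rintro (⟨hx, hxz, hvx⟩ | ⟨hvx, hxv, hxz⟩)
          · refine ⟨⟨hx, Finset.ssubset_def.2 ⟨hxz, fun h => hvx (h hv)⟩⟩, ?_⟩
            rintro rfl
            simp at hvx
          · exact ⟨⟨⟨v, hvx⟩, hxz⟩, hxv⟩
      · rintro q ⟨-, hq⟩ hvq
        exact absurd rfl (Finset.mem_erase.1 (hq hvq)).1
      · rintro p ⟨hvp, hpv, hpz⟩
        refine ⟨hvp, (hlt p hpz).trans hd, ?_, Finset.erase_subset_erase v hpz.1⟩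
        rw [Finset.nonempty_iff_ne_empty]
        intro h
        rcases Finset.erase_eq_empty_iff p v |>.1 h with h | h
        · rw [h] at hvp
          simp at hvp
        · exact hpv h

/-- The simplices of the soft refinement of an `m`-manifold `S` that approximate the subset `B`:
the small simplices contained in `B` and the facets with at least two vertices in `B`. -/
def softNhd (G : SimpleGraph V) (m : ℕ) (S B : Set V) : Set (Finset V) :=
  {z | z.Nonempty ∧ G.IsClique (z : Set V) ∧ ((↑z ⊆ B ∧ z.card < m) ∨
    (↑z ⊆ S ∧ z.card = m + 1 ∧ ((z : Set V) ∩ B).Nontrivial))}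

omit [DecidableEq V] in
theorem mem_softNhd_one [DecidableEq V] {S L : Set V} (hL : L ⊆ S) {z : Finset V} :
    z ∈ softNhd G 1 S L ↔ ∃ x ∈ L, ∃ y ∈ L, G.Adj x y ∧ z = {x, y} := by
  constructor
  · rintro ⟨hz, hc, ⟨-, h⟩ | ⟨-, h2, x, hx, y, hy, hxy⟩⟩
    · have := Finset.card_pos.2 hz
      omega
    · refine ⟨x, hx.2, y, hy.2, hc hx.1 hy.1 hxy, ?_⟩
      refine (Finset.eq_of_subset_of_card_le ?_ ?_).symm
      · intro u hu
        rcases Finset.mem_insert.1 hu with rfl | hu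
        · exact hx.1
        · rw [Finset.mem_singleton.1 hu]
          exact hy.1
      · rw [Finset.card_pair hxy, h2]
  · rintro ⟨x, hx, y, hy, hxy, rfl⟩
    refine ⟨by simp, ?_, .inr ⟨?_, Finset.card_pair hxy.ne, x, ⟨by simp, hx⟩, y, ⟨by simp, hy⟩,
      hxy.ne⟩⟩
    · rw [Finset.coe_pair, SimpleGraph.isClique_pair]
      exact fun _ => hxy
    · rw [Finset.coe_pair]
      exact Set.pair_subset (hL hx) (hL hy)

theorem softGraph_one_adj {a b : Finset V} (ha : a.card = 2) (hb : b.card = 2) :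
    (softGraph V 1).Adj a b ↔ a ≠ b ∧ (a ∩ b).Nonempty := by
  constructor
  · intro h
    refine ⟨h.ne, ?_⟩
    rcases h with h | h | h
    · have := Finset.card_lt_card h
      omega
    · have := Finset.card_lt_card h
      omega
    · exact Finset.card_pos.1 (by omega)
  · rintro ⟨hne, h⟩
    refine .inr (.inr ⟨hne, ha, hb, ?_⟩)
    have h1 := Finset.card_pos.2 h
    have h2 : (a ∩ b).card < a.card := by
      refine Finset.card_lt_card (Finset.ssubset_iff_subset_ne.2 ⟨Finset.inter_subset_left,
        fun e => hne ?_⟩)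
      exact Finset.eq_of_subset_of_card_le (Finset.inter_eq_left.1 e) (by omega)
    omega

theorem contrOn_softNhd_one [Finite V] {S L : Set V} (hS : MfdOn G 1 S) (hL : ContrOn G L)
    (hLS : L ⊆ S) (hnt : L.Nontrivial) : ContrOn (softGraph V 1) (softNhd G 1 S L) := by
  induction hL with
  | single v => exact absurd hnt Set.not_nontrivial_singleton
  | @step L v hv hl hd _ ih =>
    obtain ⟨c, hc, hvc⟩ := hl.nonempty
    have hvc' : G.Adj v c := hvc
    have huniq : ∀ y ∈ L, G.Adj v y → y = c := by
      intro y hy hvy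
      by_contra hyc
      obtain ⟨w, hw, hcw⟩ := hl.exists_adj c ⟨hc, hvc⟩ y ⟨hy, hvy⟩ hyc
      have h0 : S ∩ G.neighborSet v ∩ G.neighborSet c = ∅ := (hS v (hLS hv)).1 c ⟨hLS hc, hvc⟩
      exact (h0 ▸ ⟨⟨hLS hw.1, hw.2⟩, hcw⟩ : w ∈ (∅ : Set V))
    have hE : softNhd G 1 S L \ {{v, c}} = softNhd G 1 S (L \ {v}) := by
      ext z
      rw [Set.mem_sdiff, mem_softNhd_one hLS, mem_softNhd_one (Set.sdiff_subset.trans hLS)]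
      constructor
      · rintro ⟨⟨x, hx, y, hy, hxy, rfl⟩, hne⟩
        refine ⟨x, ⟨hx, ?_⟩, y, ⟨hy, ?_⟩, hxy, rfl⟩
        · rintro rfl
          exact hne (by rw [huniq y hy hxy]; rfl)
        · rintro rfl
          exact hne (by rw [huniq x hx hxy.symm, Finset.pair_comm]; rfl)
      · rintro ⟨x, hx, y, hy, hxy, rfl⟩
        refine ⟨⟨x, hx.1, y, hy.1, hxy, rfl⟩, fun h => ?_⟩
        have : v ∈ ({x, y} : Finset V) := by rw [show ({x, y} : Finset V) = {v, c} from h]; simp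
        rcases Finset.mem_insert.1 this with h | h
        · exact hx.2 h.symm
        · exact hy.2 (Finset.mem_singleton.1 h).symm
    have hvcE : {v, c} ∈ softNhd G 1 S L := (mem_softNhd_one hLS).2 ⟨v, hv, c, hc, hvc, rfl⟩
    by_cases hnt' : (L \ {v}).Nontrivial
    · obtain ⟨y, hy, hyc⟩ := hnt'.exists_ne c
      obtain ⟨f, hf, hcf⟩ := hd.exists_adj c ⟨hc, hvc'.ne'⟩ y hy hyc
      refine .step {v, c} hvcE ?_ (hE ▸ ih (Set.sdiff_subset.trans hLS) hnt')
      have : softNhd G 1 S L ∩ (softGraph V 1).neighborSet {v, c} = {{c, f}} := by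
        refine Set.eq_singleton_iff_unique_mem.2 ⟨⟨(mem_softNhd_one hLS).2
          ⟨c, hc, f, hf.1, hcf, rfl⟩, ?_⟩, ?_⟩
        · refine (softGraph_one_adj (Finset.card_pair hvc'.ne) (Finset.card_pair hcf.ne)).2
            ⟨fun h => ?_, c, by simp⟩
          have : v ∈ ({c, f} : Finset V) := h ▸ by simp
          rcases Finset.mem_insert.1 this with h | h
          · exact hvc'.ne h
          · exact hf.2 (Finset.mem_singleton.1 h).symm
        · rintro e ⟨he, hadj⟩
          have hadj : (softGraph V 1).Adj {v, c} e := hadj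
          have he' : e ∈ softNhd G 1 S (L \ {v}) := hE ▸ ⟨he, hadj.ne'⟩
          obtain ⟨x, hx, y, hy, hxy, rfl⟩ := (mem_softNhd_one (Set.sdiff_subset.trans hLS)).1 he'
          obtain ⟨a, b, -, -, hab⟩ := (hS c (hLS hc)).eq_pair
          have key : ∀ u ∈ L \ {v}, G.Adj c u → u = f := by
            intro u hu hcu
            have h1 : u ∈ S ∩ G.neighborSet c := ⟨hLS hu.1, hcu⟩
            have h2 : f ∈ S ∩ G.neighborSet c := ⟨hLS hf.1, hcf⟩
            have h3 : v ∈ S ∩ G.neighborSet c := ⟨hLS hv, hvc'.symm⟩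
            have h4 : u ≠ v := hu.2
            have h5 : f ≠ v := hf.2
            rw [hab] at h1 h2 h3
            simp only [Set.mem_insert_iff, Set.mem_singleton_iff] at h1 h2 h3
            grind
          obtain ⟨-, w, hw⟩ := (softGraph_one_adj (Finset.card_pair hvc'.ne)
            (Finset.card_pair hxy.ne)).1 hadj
          simp only [Finset.mem_inter, Finset.mem_insert, Finset.mem_singleton] at hw
          have h4 : x ≠ v := hx.2
          have h5 : y ≠ v := hy.2
          obtain rfl | rfl : c = x ∨ c = y := by grind
          · rw [key y hy hxy]
          · rw [key x hx hxy.symm, Finset.pair_comm]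
      rw [this]
      exact .single _
    · have : softNhd G 1 S L = {{v, c}} := by
        refine Set.eq_singleton_iff_unique_mem.2 ⟨hvcE, fun e he => ?_⟩
        by_contra hne
        have he' : e ∈ softNhd G 1 S (L \ {v}) := hE ▸ ⟨he, hne⟩
        obtain ⟨x, hx, y, hy, hxy, -⟩ := (mem_softNhd_one (Set.sdiff_subset.trans hLS)).1 he'
        exact hnt' ⟨x, hx, y, hy, hxy.ne⟩
      rw [this]
      exact .single _

end SoftContractible

section SoftLink

variable {V : Type*} [DecidableEq V] {G : SimpleGraph V}

theorem contrOn_link_facet [Finite V] {m : ℕ} {S B : Set V} (hS : MfdOn G m S) (hm : 2 ≤ m)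
    {t w : Finset V} {v b : V} (ht : G.IsClique (t : Set V)) (htS : ↑t ⊆ S) (htc : t.card = m + 1)
    (hvb : v ≠ b) (hvt : v ∈ t) (hbt : b ∈ t) (htB : (t : Set V) ∩ B ⊆ {v, b})
    {Y : Set (Finset V)} (hY : Y ⊆ softNhd G m S B) (hvY : {v} ∈ Y) (hbY : {b} ∈ Y)
    (hwY : w ∈ Y) (hwv : v ∈ w) (hwb : b ∈ w) (hwt : (softGraph V m).Adj t w)
    (hw : w ⊆ {v, b} ∨ m = 2) :
    ContrOn (softGraph V m) (Y ∩ (softGraph V m).neighborSet t) := by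
  have hcard : ∀ y ∈ Y, (softGraph V m).Adj t y →
      (y.card < m ∧ y.Nonempty ∧ y ⊆ {v, b}) ∨ (G.IsClique (y : Set V) ∧ ↑y ⊆ S ∧
        y.card = m + 1 ∧ (y ∩ t).card = m ∧ y ≠ t) := by
    intro y hy hty
    obtain ⟨hne, hyc, ⟨hyB, hym⟩ | ⟨hyS, hym, -⟩⟩ := hY hy
    · refine .inl ⟨hym, hne, ?_⟩
      rcases hty with hty | hty | hty
      · have := Finset.card_lt_card hty
        omega
      · intro x hx
        simpa using htB ⟨hty.1 hx, hyB hx⟩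
      · omega
    · refine .inr ⟨hyc, hyS, hym, ?_, hty.ne'⟩
      rcases hty with hty | hty | hty
      · have := Finset.card_lt_card hty
        omega
      · have := Finset.card_lt_card hty
        omega
      · rw [Finset.inter_comm]
        exact hty.2.2.2
  have hpair : ({v, b} : Finset V).card = 2 := Finset.card_pair hvb
  have hvbw : {v, b} ⊆ w := by
    intro x hx
    rcases Finset.mem_insert.1 hx with rfl | hx
    · exact hwv
    · rwa [Finset.mem_singleton.1 hx]
  set X := {y | y ∈ Y ∧ (softGraph V m).Adj t y ∧ (y.card < m ∨ (v ∈ y ∧ b ∈ y))} with hXdef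
  set R := {y | y ∈ Y ∧ (softGraph V m).Adj t y ∧ ¬ (y.card < m ∨ (v ∈ y ∧ b ∈ y))} with hRdef
  have hXR : Y ∩ (softGraph V m).neighborSet t = X ∪ R := by
    ext y
    simp only [hXdef, hRdef, Set.mem_inter_iff, SimpleGraph.mem_neighborSet, Set.mem_union,
      Set.mem_ofPred_eq]
    tauto
  have hX : ContrOn (softGraph V m) X := by
    refine contrOn_of_apex (a := w) ⟨hwY, hwt, .inr ⟨hwv, hwb⟩⟩ ?_
    rintro y ⟨hyY, hty, hyc⟩ hne
    rcases hcard y hyY hty with ⟨h1, h2, h3⟩ | ⟨h1, h2, h3, h4, h5⟩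
    · exact .inr (.inl (Finset.ssubset_iff_subset_ne.2 ⟨h3.trans hvbw, hne⟩))
    · have hyvb : {v, b} ⊆ y := by
        obtain ⟨hy1, hy2⟩ := hyc.resolve_left (by omega)
        intro x hx
        rcases Finset.mem_insert.1 hx with rfl | hx
        · exact hy1
        · rwa [Finset.mem_singleton.1 hx]
      rcases hw with hw | rfl
      · exact .inl (Finset.ssubset_iff_subset_ne.2 ⟨hw.trans hyvb, hne.symm⟩)
      · rcases hcard w hwY hwt with ⟨k1, -, k3⟩ | ⟨k1, k2, k3, k4, k5⟩
        · have := Finset.card_le_card hvbw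
          omega
        · refine (hne ?_).elim
          refine hS.facet_unique (by omega) hpair ht htS htc ?_ h1 h2 h3 hyvb k1 k2 k3 hvbw h5 k5
          intro x hx
          rcases Finset.mem_insert.1 hx with rfl | hx
          · exact hvt
          · rwa [Finset.mem_singleton.1 hx]
  rw [hXR]
  refine hX.union_of_links (fun _ => 0) ?_ ?_
  · exact Set.disjoint_left.2 fun y hy hy' => hy'.2.2 hy.2.2
  rintro p ⟨hpY, htp, hpn⟩ Q hQ hpQ -
  rcases hcard p hpY htp with ⟨h1, -⟩ | ⟨h1, h2, h3, h4, h5⟩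
  · exact (hpn (.inl h1)).elim
  have hlow : ∀ c ∈ t, {c} ∈ Y → {c} ∈ X := fun c hc hcY => by
    refine ⟨hcY, .inr (.inl ?_), .inl (by simp; omega)⟩
    refine Finset.ssubset_iff_subset_ne.2 ⟨by simpa using hc, ?_⟩
    rintro rfl
    simp at htc
    omega
  have hsub : ∀ c ∈ p, (softGraph V m).Adj p {c} := fun c hc => by
    refine .inr (.inl (Finset.ssubset_iff_subset_ne.2 ⟨by simpa using hc, ?_⟩))
    rintro rfl
    simp at h3
    omega
  have hlink : ∀ y ∈ (X ∪ Q) ∩ (softGraph V m).neighborSet p, y.Nonempty ∧ y ⊆ {v, b} ∧ y ⊆ p := by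
    rintro y ⟨hy, hpy⟩
    have hy' : y ∈ Y ∧ (softGraph V m).Adj t y := by
      rcases hy with hy | hy
      · exact ⟨hy.1, hy.2.1⟩
      · exact ⟨(hQ hy).1, (hQ hy).2.1⟩
    have hpy' : (softGraph V m).Adj p y := hpy
    rcases hcard y hy'.1 hy'.2 with ⟨k1, k2, k3⟩ | ⟨k1, k2, k3, k4, k5⟩
    · refine ⟨k2, k3, ?_⟩
      rcases hpy' with h | h | h
      · have := Finset.card_lt_card h
        omega
      · exact h.1
      · omega
    · exfalso
      have := hS.not_adj_of_adj_facet (by omega) ht htS htc h1 h2 h3 h4 k1 k2 k3 k4 hpy'.ne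
      rcases hpy' with h | h | h
      · have := Finset.card_lt_card h
        omega
      · have := Finset.card_lt_card h
        omega
      · exact this h.2.2.2
  have hor : v ∈ p ∨ b ∈ p := by
    by_contra! hcon
    have : p ∩ t ⊆ (t.erase v).erase b := by
      intro x hx
      rw [Finset.mem_inter] at hx
      refine Finset.mem_erase.2 ⟨?_, Finset.mem_erase.2 ⟨?_, hx.2⟩⟩
      · rintro rfl
        exact hcon.2 hx.1
      · rintro rfl
        exact hcon.1 hx.1
    have := Finset.card_le_card this
    rw [Finset.card_erase_of_mem (Finset.mem_erase.2 ⟨hvb.symm, hbt⟩),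
      Finset.card_erase_of_mem hvt] at this
    omega
  have hfin : ∀ c, (∀ x, (x = v ∨ x = b) → x ∈ p → x = c) → c ∈ p → c ∈ t → {c} ∈ Y →
      ContrOn (softGraph V m) ((X ∪ Q) ∩ (softGraph V m).neighborSet p) := by
    intro c hc hcp hct hcY
    have : (X ∪ Q) ∩ (softGraph V m).neighborSet p = {{c}} := by
      refine Set.eq_singleton_iff_unique_mem.2 ⟨⟨.inl (hlow c hct hcY), hsub c hcp⟩, ?_⟩
      intro y hy
      obtain ⟨k1, k2, k3⟩ := hlink y hy
      refine Finset.eq_singleton_iff_nonempty_unique_mem.2 ⟨k1, fun x hx => ?_⟩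
      exact hc x (by simpa using k2 hx) (k3 hx)
    rw [this]
    exact .single _
  rcases hor with hv | hb
  · refine hfin v ?_ hv hvt hvY
    rintro x (rfl | rfl) hx
    · rfl
    · exact (hpn (.inr ⟨hv, hx⟩)).elim
  · refine hfin b ?_ hb hbt hbY
    rintro x (rfl | rfl) hx
    · exact (hpn (.inr ⟨hx, hb⟩)).elim
    · rfl

end SoftLink

section SoftStep

variable {V : Type*} [DecidableEq V] {G : SimpleGraph V}

omit [DecidableEq V] in
theorem ContrOn.insert_vertex {X : Set V} {p : V} (hX : ContrOn G X) (hp : p ∉ X)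
    (hl : ContrOn G (X ∩ G.neighborSet p)) : ContrOn G (insert p X) := by
  refine .step p (Set.mem_insert p X) ?_ ?_
  · have hpp : p ∉ G.neighborSet p := G.irrefl
    rwa [Set.insert_inter_of_notMem hpp]
  · rwa [Set.insert_sdiff_of_mem _ (Set.mem_singleton p), Set.sdiff_singleton_eq_self hp]

/-- The facets of `S` through `v` having exactly one more vertex in `B`. -/
def edgeFacets (G : SimpleGraph V) (m : ℕ) (S B : Set V) (v : V) : Set (Finset V) :=
  {t | G.IsClique (t : Set V) ∧ ↑t ⊆ S ∧ t.card = m + 1 ∧ v ∈ t ∧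
    ∃ b ∈ B, b ≠ v ∧ b ∈ t ∧ (t : Set V) ∩ B ⊆ {v, b}}

/-- The small simplices of `B` of positive dimension containing `v`. -/
def lowStar (G : SimpleGraph V) (m : ℕ) (B : Set V) (v : V) : Set (Finset V) :=
  {z | G.IsClique (z : Set V) ∧ ↑z ⊆ B ∧ v ∈ z ∧ 2 ≤ z.card ∧ z.card < m}

omit [DecidableEq V] in
theorem softNhd_eq_union {m : ℕ} (hm : 2 ≤ m) {S B : Set V} {v : V} (hv : v ∈ B) :
    softNhd G m S B =
      insert {v} (softNhd G m S (B \ {v}) ∪ lowStar G m B v) ∪ edgeFacets G m S B v := by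
  ext z
  constructor
  · rintro ⟨hz, hzc, ⟨hzB, hzm⟩ | ⟨hzS, hzm, x, hx, y, hy, hxy⟩⟩
    · refine .inl ?_
      by_cases hvz : v ∈ z
      · by_cases h2 : 2 ≤ z.card
        · exact .inr (.inr ⟨hzc, hzB, hvz, h2, hzm⟩)
        · refine .inl ?_
          have := Finset.card_pos.2 hz
          obtain ⟨u, rfl⟩ := Finset.card_eq_one.1 (show z.card = 1 by omega)
          rw [Finset.mem_singleton.1 hvz]
      · exact .inr (.inl ⟨hz, hzc, .inl ⟨fun u hu => ⟨hzB hu, fun h => hvz (h ▸ hu)⟩, hzm⟩⟩)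
    · by_cases hnt : ((z : Set V) ∩ (B \ {v})).Nontrivial
      · exact .inl (.inr (.inl ⟨hz, hzc, .inr ⟨hzS, hzm, hnt⟩⟩))
      · right
        have key : ∀ x ∈ (z : Set V) ∩ B, ∀ y ∈ (z : Set V) ∩ B, x ≠ v → y ≠ v → x = y := by
          intro x hx y hy hxv hyv
          by_contra hxy
          exact hnt ⟨x, ⟨hx.1, hx.2, hxv⟩, y, ⟨hy.1, hy.2, hyv⟩, hxy⟩
        have hvz : v ∈ z := by
          by_contra hvz
          exact hxy (key x hx y hy (fun h => hvz (h ▸ hx.1)) (fun h => hvz (h ▸ hy.1)))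
        obtain ⟨b, hb, hbv⟩ : ∃ b ∈ (z : Set V) ∩ B, b ≠ v := by
          by_cases hxv : x = v
          · exact ⟨y, hy, fun h => hxy (hxv.trans h.symm)⟩
          · exact ⟨x, hx, hxv⟩
        refine ⟨hzc, hzS, hzm, hvz, b, hb.2, hbv, hb.1, fun u hu => ?_⟩
        by_cases huv : u = v
        · exact .inl huv
        · exact .inr (key u hu b hb huv hbv)
  · rintro ((rfl | hz | ⟨hzc, hzB, hvz, -, hzm⟩) | ⟨hzc, hzS, hzm, hvz, b, hb, hbv, hbz, -⟩)
    · exact ⟨by simp, by simp, .inl ⟨by simpa using hv, by simp; omega⟩⟩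
    · obtain ⟨hne, hzc, ⟨hzB, hzm⟩ | ⟨hzS, hzm, hnt⟩⟩ := hz
      · exact ⟨hne, hzc, .inl ⟨hzB.trans Set.sdiff_subset, hzm⟩⟩
      · exact ⟨hne, hzc, .inr ⟨hzS, hzm,
          hnt.mono (Set.inter_subset_inter_right _ Set.sdiff_subset)⟩⟩
    · exact ⟨⟨v, hvz⟩, hzc, .inl ⟨hzB, hzm⟩⟩
    · exact ⟨⟨v, hvz⟩, hzc, .inr ⟨hzS, hzm, b, ⟨hbz, hb⟩, v, ⟨hvz, hv⟩, hbv⟩⟩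

theorem union_inter_neighborSet_singleton {k : ℕ} (hk : 1 ≤ k) {S B : Set V} {v : V}
    (hBS : B ⊆ S) (hv : v ∈ B) :
    (softNhd G (k + 1) S (B \ {v}) ∪ lowStar G (k + 1) B v) ∩ (softGraph V (k + 1)).neighborSet {v} =
      ({v} ∪ ·) '' softNhd G k (S ∩ G.neighborSet v) (B ∩ G.neighborSet v) := by
  ext y
  constructor
  · rintro ⟨hy, hvy⟩
    have hvy : (softGraph V (k + 1)).Adj {v} y := hvy
    have hvy' : v ∈ y ∧ y ≠ {v} := by
      refine ⟨?_, hvy.ne'⟩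
      rcases hvy with h | h | h
      · exact Finset.singleton_subset_iff.1 h.1
      · have h0 : y = ∅ := Finset.ssubset_singleton_iff.1 h
        rcases hy with hy | hy
        · rw [h0] at hy
          exact absurd hy.1 (by simp)
        · exact hy.2.2.1
      · have := h.2.1
        simp at this
    obtain ⟨hvy, hne⟩ := hvy'
    have hyc : G.IsClique (y : Set V) := by
      rcases hy with hy | hy
      · exact hy.2.1
      · exact hy.1
    have hadj : ∀ x ∈ y.erase v, G.Adj v x := fun x hx =>
      hyc hvy (Finset.mem_of_mem_erase hx) (Finset.ne_of_mem_erase hx).symm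
    have hyne : (y.erase v).Nonempty := by
      rw [Finset.nonempty_iff_ne_empty, Ne, Finset.erase_eq_empty_iff, not_or]
      exact ⟨Finset.ne_empty_of_mem hvy, hne⟩
    have hce := Finset.card_erase_of_mem hvy
    refine ⟨y.erase v, ⟨hyne, hyc.subset (by simp), ?_⟩, ?_⟩
    · rcases hy with hy | hy
      · obtain ⟨-, -, ⟨hyB, -⟩ | ⟨hyS, hym, x, hx, z, hz, hxz⟩⟩ := hy
        · exact absurd rfl (hyB hvy).2
        · refine .inr ⟨fun u hu => ⟨hyS (Finset.mem_of_mem_erase hu), hadj u hu⟩, by omega, ?_⟩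
          have h1 : ∀ x ∈ (y : Set V) ∩ (B \ {v}),
              x ∈ (y.erase v : Set V) ∩ (B ∩ G.neighborSet v) := fun x hx =>
            have hx' : x ∈ y.erase v := Finset.mem_erase.2 ⟨hx.2.2, hx.1⟩
            ⟨hx', hx.2.1, hadj x hx'⟩
          exact ⟨x, h1 x hx, z, h1 z hz, hxz⟩
      · exact .inl ⟨fun u hu => ⟨hy.2.1 (Finset.mem_of_mem_erase hu), hadj u hu⟩,
          by have := hy.2.2.2; omega⟩
    · change {v} ∪ y.erase v = y
      rw [← Finset.insert_eq, Finset.insert_erase hvy]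
  · rintro ⟨y, ⟨hne, hyc, hy⟩, rfl⟩
    have hvy : v ∉ y := by
      intro hvy
      rcases hy with hy | hy
      · exact G.irrefl (hy.1 hvy).2
      · exact G.irrefl (hy.1 hvy).2
    change {v} ∪ y ∈ _
    rw [← Finset.insert_eq]
    have hcard := Finset.card_insert_of_notMem hvy
    have hpos := Finset.card_pos.2 hne
    have hc : G.IsClique (insert v y : Finset V) := by
      rw [Finset.coe_insert, SimpleGraph.isClique_insert]
      refine ⟨hyc, fun x hx _ => ?_⟩
      rcases hy with hy | hy
      · exact (hy.1 hx).2
      · exact (hy.1 hx).2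
    refine ⟨?_, .inl (Finset.ssubset_iff_subset_ne.2 ⟨by simp, fun h => ?_⟩)⟩
    · rcases hy with ⟨hyB, hym⟩ | ⟨hyS, hym, x, hx, z, hz, hxz⟩
      · refine .inr ⟨hc, ?_, by simp, by omega, by omega⟩
        rw [Finset.coe_insert]
        exact Set.insert_subset hv fun u hu => (hyB hu).1
      · refine .inl ⟨by simp, hc, .inr ⟨?_, by omega, ?_⟩⟩
        · rw [Finset.coe_insert]
          exact Set.insert_subset (hBS hv) fun u hu => (hyS hu).1
        · have h1 : ∀ x ∈ (y : Set V) ∩ (B ∩ G.neighborSet v),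
              x ∈ ((insert v y : Finset V) : Set V) ∩ (B \ {v}) := fun x hx =>
            ⟨by simp [Finset.mem_coe.1 hx.1], hx.2.1, fun h => hvy (h ▸ hx.1)⟩
          exact ⟨x, h1 x hx, z, h1 z hz, hxz⟩
    · rw [← h, Finset.card_singleton] at hcard
      omega

omit [DecidableEq V] in
theorem disjoint_edgeFacets {m : ℕ} {S B : Set V} {v : V} (hm : 1 ≤ m) :
    Disjoint (insert {v} (softNhd G m S (B \ {v}) ∪ lowStar G m B v)) (edgeFacets G m S B v) := by
  rw [Set.disjoint_left]
  rintro t ht ⟨-, -, htm, hvt, b, -, -, -, htB⟩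
  rcases ht with rfl | ⟨-, -, ⟨h, -⟩ | ⟨-, -, x, hx, y, hy, hxy⟩⟩ | h
  · simp at htm
    omega
  · exact (h hvt).2 rfl
  · have key : ∀ x ∈ (t : Set V) ∩ (B \ {v}), x = b := fun x hx =>
      (htB ⟨hx.1, hx.2.1⟩).resolve_left hx.2.2
    exact hxy ((key x hx).trans (key y hy).symm)
  · have := h.2.2.2.2
    omega

theorem contrOn_softNhd_of_nontrivial [Finite V] {k : ℕ} (hk : 1 ≤ k) {S B : Set V} {v : V}
    (hS : MfdOn G (k + 1) S) (hBS : B ⊆ S) (hv : v ∈ B)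
    (hL : ContrOn G (B ∩ G.neighborSet v)) (hnt : k = 1 → (B ∩ G.neighborSet v).Nontrivial)
    (hl : ContrOn (softGraph V k) (softNhd G k (S ∩ G.neighborSet v) (B ∩ G.neighborSet v)))
    (h0 : ContrOn (softGraph V (k + 1)) (softNhd G (k + 1) S (B \ {v}))) :
    ContrOn (softGraph V (k + 1)) (softNhd G (k + 1) S B) := by
  have h1 : ContrOn (softGraph V (k + 1))
      (softNhd G (k + 1) S (B \ {v}) ∪ lowStar G (k + 1) B v) := by
    refine h0.union_star v ?_ ?_
    · rintro q ⟨-, -, ⟨hq, -⟩ | ⟨-, hq, -⟩⟩ hvq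
      · exact absurd rfl (hq hvq).2
      · omega
    · rintro p ⟨hpc, hpB, hvp, hp2, hpm⟩
      have := Finset.card_erase_of_mem hvp
      refine ⟨hvp, hpm.le, Finset.card_pos.1 (by omega), hpc.subset (by simp), .inl ⟨?_, by omega⟩⟩
      intro u hu
      exact ⟨hpB (Finset.mem_of_mem_erase hu), Finset.ne_of_mem_erase hu⟩
  have h2 : ContrOn (softGraph V (k + 1))
      (insert {v} (softNhd G (k + 1) S (B \ {v}) ∪ lowStar G (k + 1) B v)) := by
    refine h1.insert_vertex ?_ ?_
    · rintro (⟨-, -, ⟨h, -⟩ | ⟨-, h, -⟩⟩ | h)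
      · exact (h (by simp : v ∈ (({v} : Finset V) : Set V))).2 rfl
      · simp at h
      · have := h.2.2.2.1
        simp at this
    · rw [union_inter_neighborSet_singleton hk hBS hv]
      have hdis : ∀ a ∈ softNhd G k (S ∩ G.neighborSet v) (B ∩ G.neighborSet v),
          Disjoint {v} a := by
        rintro a ⟨-, -, ⟨h, -⟩ | ⟨h, -⟩⟩ <;>
          exact Finset.disjoint_singleton_left.2 fun hva => G.irrefl (h hva).2
      refine hl.map _ ?_ fun a ha b hb => softGraph_union_adj (hdis a ha) (hdis b hb) (by simp)
      intro a ha b hb hab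
      have := congrArg (· \ {v}) hab
      simpa only [Finset.union_sdiff_cancel_left (hdis a ha),
        Finset.union_sdiff_cancel_left (hdis b hb)] using this
  have heq := softNhd_eq_union (G := G) (m := k + 1) (by omega) (S := S) hv
  rw [heq]
  refine h2.union_of_links (fun _ => 0) (disjoint_edgeFacets (by omega)) ?_
  rintro t ⟨htc, htS, htm, hvt, b, hbB, hbv, hbt, htB⟩ Q hQ - -
  have hvb : G.Adj v b := htc hvt hbt hbv.symm
  obtain ⟨w, hwY, hwv, hwb, hwt, hw⟩ : ∃ w ∈ softNhd G (k + 1) S (B \ {v}) ∪ lowStar G (k + 1) B v,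
      v ∈ w ∧ b ∈ w ∧ (softGraph V (k + 1)).Adj t w ∧ (w ⊆ {v, b} ∨ k + 1 = 2) := by
    rcases hk.eq_or_lt with rfl | hk
    · obtain ⟨y, hy, hyb⟩ := (hnt rfl).exists_ne b
      obtain ⟨c, hc, hbc⟩ := hL.exists_adj b ⟨hbB, hvb⟩ y hy hyb
      have hvc : G.Adj v c := hc.2
      have hcard : ({v, b, c} : Finset V).card = 3 :=
        Finset.card_eq_three.2 ⟨v, b, c, hvb.ne, hvc.ne, hbc.ne, rfl⟩
      have hct : c ∉ t := fun hct => by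
        rcases htB ⟨hct, hc.1⟩ with h | h
        · exact hvc.ne h.symm
        · exact hbc.ne h.symm
      refine ⟨{v, b, c}, .inl ⟨by simp, ?_, .inr ⟨?_, hcard, b, ⟨by simp, hbB, hbv⟩,
        c, ⟨by simp, hc.1, hvc.ne'⟩, hbc.ne⟩⟩, by simp, by simp, .inr (.inr ⟨?_, htm, hcard, ?_⟩),
        .inr rfl⟩
      · simp only [Finset.coe_insert, Finset.coe_singleton, SimpleGraph.isClique_insert]
        simp [hvb, hvc, hbc]
      · simp only [Finset.coe_insert, Finset.coe_singleton]
        exact Set.insert_subset (hBS hv) (Set.pair_subset (hBS hbB) (hBS hc.1))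
      · rintro rfl
        simp at hct
      · have : t ∩ {v, b, c} = {v, b} := by
          ext u
          simp only [Finset.mem_inter, Finset.mem_insert, Finset.mem_singleton]
          constructor
          · rintro ⟨hu, h | h | rfl⟩
            exacts [.inl h, .inr h, (hct hu).elim]
          · rintro (rfl | rfl)
            exacts [⟨hvt, .inl rfl⟩, ⟨hbt, .inr (.inl rfl)⟩]
        rw [this, Finset.card_pair hvb.ne]
    · refine ⟨{v, b}, .inr ⟨?_, ?_, by simp, ?_, ?_⟩, by simp, by simp, .inr (.inl ?_),
        .inl le_rfl⟩
      · rw [Finset.coe_pair, SimpleGraph.isClique_pair]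
        exact fun _ => hvb
      · rw [Finset.coe_pair]
        exact Set.pair_subset hv hbB
      · rw [Finset.card_pair hvb.ne]
      · rw [Finset.card_pair hvb.ne]
        omega
      · refine Finset.ssubset_iff_subset_ne.2 ⟨?_, fun h => ?_⟩
        · intro x hx
          rcases Finset.mem_insert.1 hx with rfl | hx
          · exact hvt
          · rwa [Finset.mem_singleton.1 hx]
        · rw [← h, Finset.card_pair hvb.ne] at htm
          omega
  refine contrOn_link_facet (w := w) hS (by omega) htc htS htm hbv.symm hvt hbt htB ?_ ?_ ?_ ?_ hwv
    hwb hwt hw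
  · rw [heq]
    exact Set.union_subset_union_right _ hQ
  · exact .inl (.inl rfl)
  · exact .inl (.inr (.inl ⟨by simp, by simp, .inl ⟨by simpa using ⟨hbB, hbv⟩, by simp; omega⟩⟩))
  · exact .inl (.inr hwY)

theorem contrOn_softNhd_of_leaf [Finite V] {S B : Set V} {v b : V}
    (hS : MfdOn G 2 S) (hBS : B ⊆ S) (hv : v ∈ B) (hL : B ∩ G.neighborSet v = {b})
    (h0 : ContrOn (softGraph V 2) (softNhd G 2 S (B \ {v}))) :
    ContrOn (softGraph V 2) (softNhd G 2 S B) := by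
  obtain ⟨hbB, hvb'⟩ : b ∈ B ∩ G.neighborSet v := hL ▸ Set.mem_singleton b
  have hvb : G.Adj v b := hvb'
  have huniq : ∀ u ∈ B, G.Adj v u → u = b := fun u hu hvu =>
    (hL ▸ ⟨hu, hvu⟩ : u ∈ ({b} : Set V))
  have heq := softNhd_eq_union (G := G) (m := 2) le_rfl (S := S) hv
  have hlow : lowStar G 2 B v = ∅ :=
    Set.eq_empty_of_forall_notMem fun z hz => by
      have := hz.2.2.2
      omega
  have hdis := disjoint_edgeFacets (G := G) (m := 2) (S := S) (B := B) (v := v) (by omega)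
  rw [hlow, Set.union_empty] at heq hdis
  have hv0 : ∀ y ∈ softNhd G 2 S (B \ {v}), v ∉ y := by
    rintro y ⟨-, hyc, ⟨hy, -⟩ | ⟨-, -, x, hx, z, hz, hxz⟩⟩ hvy
    · exact (hy hvy).2 rfl
    · have key : ∀ x ∈ (y : Set V) ∩ (B \ {v}), x = b := fun x hx =>
        huniq x hx.2.1 (hyc hvy hx.1 (Ne.symm hx.2.2))
      exact hxz ((key x hx).trans (key z hz).symm)
  have hb0 : {b} ∈ softNhd G 2 S (B \ {v}) :=
    ⟨by simp, by simp, .inl ⟨by simpa using ⟨hbB, hvb.ne'⟩, by simp⟩⟩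
  have hRb : ∀ t ∈ edgeFacets G 2 S B v, b ∈ t := by
    rintro t ⟨htc, -, -, hvt, c, hcB, hcv, hct, -⟩
    rwa [← huniq c hcB (htc hvt hct hcv.symm)]
  have hsing : ∀ t ∈ edgeFacets G 2 S B v, ∀ c ∈ t, {c} ⊂ t := fun t ht c hc =>
    Finset.ssubset_iff_subset_ne.2 ⟨by simpa using hc, fun h => by
      have := ht.2.2.1
      rw [← h] at this
      simp at this⟩
  obtain ⟨t₀, ht₀⟩ : (edgeFacets G 2 S B v).Nonempty := by
    have hc : G.IsClique (({v, b} : Finset V) : Set V) := by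
      rw [Finset.coe_pair, SimpleGraph.isClique_pair]
      exact fun _ => hvb
    have hsub : (({v, b} : Finset V) : Set V) ⊆ S := by
      rw [Finset.coe_pair]
      exact Set.pair_subset (hBS hv) (hBS hbB)
    obtain ⟨a, _, -, -, ha⟩ := hS.link_pair (by omega) hc hsub (Finset.card_pair hvb.ne)
    have ha' : a ∈ commonLink G S {v, b} := ha ▸ Set.mem_insert _ _
    have hclique := isClique_insert_of_mem_commonLink hc ha'
    refine ⟨insert a {v, b}, hclique, ?_, ?_, by simp, b, hbB, hvb.ne', by simp, ?_⟩
    · rw [Finset.coe_insert]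
      exact Set.insert_subset ha'.1 hsub
    · rw [Finset.card_insert_of_notMem (notMem_of_mem_commonLink ha'), Finset.card_pair hvb.ne]
    · rintro u ⟨hu, huB⟩
      by_cases huv : u = v
      · exact .inl huv
      · exact .inr (huniq u huB (hclique (by simp) hu (Ne.symm huv)))
  have h1 : ContrOn (softGraph V 2) (insert t₀ (softNhd G 2 S (B \ {v}))) := by
    refine h0.insert_vertex (fun h => hv0 _ h ht₀.2.2.2.1) ?_
    refine contrOn_of_apex (a := {b})
      ⟨hb0, .inr (.inl (hsing t₀ ht₀ b (hRb t₀ ht₀)))⟩ ?_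
    rintro y ⟨hy, hty⟩ hne
    have hvy := hv0 y hy
    have hby : b ∈ y := by
      rcases hy.2.2 with ⟨hyB, hyc⟩ | ⟨-, hyc, -⟩
      · rcases hty with h | h | h
        · have := Finset.card_lt_card h
          have := ht₀.2.2.1
          omega
        · obtain ⟨u, hu⟩ := hy.1
          rwa [← huniq u (hyB hu).1 (ht₀.1 ht₀.2.2.2.1 (h.1 hu) (by rintro rfl; exact hvy hu))]
        · omega
      · rcases hty with h | h | h
        · exact absurd (h.1 ht₀.2.2.2.1) hvy
        · have := Finset.card_lt_card h
          have := ht₀.2.2.1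
          omega
        · have h4 := h.2.2.2
          by_contra hby
          have : t₀ ∩ y ⊆ (t₀.erase v).erase b := fun x hx => by
            rw [Finset.mem_inter] at hx
            refine Finset.mem_erase.2 ⟨?_, Finset.mem_erase.2 ⟨?_, hx.1⟩⟩
            · rintro rfl
              exact hby hx.2
            · rintro rfl
              exact hvy hx.2
          have := Finset.card_le_card this
          rw [Finset.card_erase_of_mem (Finset.mem_erase.2 ⟨hvb.ne', hRb t₀ ht₀⟩),
            Finset.card_erase_of_mem ht₀.2.2.2.1, h4, ht₀.2.2.1] at this
          omega
    exact .inl (Finset.ssubset_iff_subset_ne.2 ⟨by simpa using hby, hne.symm⟩)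
  have hvt₀ := hsing t₀ ht₀ v ht₀.2.2.2.1
  have h2 : ContrOn (softGraph V 2) (insert {v} (insert t₀ (softNhd G 2 S (B \ {v})))) := by
    refine h1.insert_vertex ?_ ?_
    · rintro (h | h)
      · exact hvt₀.ne h
      · exact hv0 _ h (by simp)
    · have : insert t₀ (softNhd G 2 S (B \ {v})) ∩ (softGraph V 2).neighborSet {v} = {t₀} := by
        refine Set.eq_singleton_iff_unique_mem.2 ⟨⟨Set.mem_insert _ _, .inl hvt₀⟩, ?_⟩
        rintro y ⟨rfl | hy, hvy⟩
        · rfl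
        · exfalso
          rcases hvy with h | h | h
          · exact hv0 y hy (Finset.singleton_subset_iff.1 h.1)
          · exact hy.1.ne_empty (Finset.ssubset_singleton_iff.1 h)
          · have := h.2.1
            simp at this
      rw [this]
      exact .single _
  have heq' : softNhd G 2 S B = insert {v} (insert t₀ (softNhd G 2 S (B \ {v}))) ∪
      (edgeFacets G 2 S B v \ {t₀}) := by
    rw [heq]
    ext y
    by_cases hy : y = t₀
    · simp [hy, ht₀]
    · simp [hy]
  rw [heq']
  refine h2.union_of_links (fun _ => 0) ?_ ?_
  · rw [Set.insert_comm]
    refine Set.disjoint_insert_left.2 ⟨fun h => h.2 rfl, hdis.mono_right Set.sdiff_subset⟩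
  rintro t ⟨ht, htne⟩ Q hQ - -
  have hbt := hRb t ht
  obtain ⟨htc, htS, htm, hvt, -⟩ := ht
  refine contrOn_link_facet (B := B) (w := t₀) (v := v) (b := b) hS le_rfl htc htS htm hvb.ne hvt hbt ?_ ?_
    (.inl (.inl rfl)) (.inl (.inr (.inr hb0))) (.inl (.inr (.inl rfl))) ht₀.2.2.2.1
    (hRb t₀ ht₀) (.inr (.inr ⟨htne, htm, ht₀.2.2.1, ?_⟩)) (.inr rfl)
  · rintro u ⟨hu, huB⟩
    by_cases huv : u = v
    · exact .inl huv
    · exact .inr (huniq u huB (htc hvt hu (Ne.symm huv)))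
  · rw [heq']
    exact Set.union_subset_union_right _ hQ
  · have hle : ({v, b} : Finset V) ⊆ t ∩ t₀ := by
      intro x hx
      rcases Finset.mem_insert.1 hx with rfl | hx
      · exact Finset.mem_inter.2 ⟨hvt, ht₀.2.2.2.1⟩
      · rw [Finset.mem_singleton.1 hx]
        exact Finset.mem_inter.2 ⟨hbt, hRb t₀ ht₀⟩
    have h3 := Finset.card_le_card hle
    rw [Finset.card_pair hvb.ne] at h3
    have h4 : (t ∩ t₀).card < t.card := by
      refine Finset.card_lt_card (Finset.ssubset_iff_subset_ne.2 ⟨Finset.inter_subset_left,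
        fun e => htne ?_⟩)
      exact Finset.eq_of_subset_of_card_le (Finset.inter_eq_left.1 e) (by have := ht₀.2.2.1; omega)
    omega

theorem contrOn_softNhd [Finite V] {m : ℕ} (hm : 1 ≤ m) {S B : Set V} (hS : MfdOn G m S)
    (hB : ContrOn G B) (hBS : B ⊆ S) (hnt : m = 1 → B.Nontrivial) :
    ContrOn (softGraph V m) (softNhd G m S B) := by
  induction m, hm using Nat.le_induction generalizing S B with
  | base => exact contrOn_softNhd_one hS hB hBS (hnt rfl)
  | succ k hk ihk =>
    clear hnt
    induction hB with
    | single b =>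
      have : softNhd G (k + 1) S {b} = {{b}} := by
        refine Set.eq_singleton_iff_unique_mem.2 ⟨⟨by simp, by simp, .inl ⟨by simp,
          by simp; omega⟩⟩, ?_⟩
        rintro z ⟨hz, -, ⟨h, -⟩ | ⟨-, -, h⟩⟩
        · exact Finset.eq_singleton_iff_nonempty_unique_mem.2 ⟨hz, fun x hx => h hx⟩
        · exact absurd (h.mono Set.inter_subset_right) Set.not_nontrivial_singleton
      rw [this]
      exact .single _
    | @step B v hv hl _ _ ih =>
      have h0 := ih (Set.sdiff_subset.trans hBS)
      have hSv : MfdOn G k (S ∩ G.neighborSet v) := (hS v (hBS hv)).1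
      by_cases hnt : k = 1 → (B ∩ G.neighborSet v).Nontrivial
      · exact contrOn_softNhd_of_nontrivial hk hS hBS hv hl hnt
          (ihk hSv hl (Set.inter_subset_inter_left _ hBS) hnt) h0
      · obtain ⟨rfl, hnt'⟩ := Classical.not_imp.1 hnt
        obtain ⟨b, hb⟩ := hl.nonempty
        exact contrOn_softNhd_of_leaf hS hBS hv
          ((Set.not_nontrivial_iff.1 hnt').eq_singleton_of_mem hb) h0

end SoftStep

section SoftSphere

variable {V : Type*} [DecidableEq V] {G : SimpleGraph V}

/-- The nonempty cliques in `S` whose number of elements is not `m`. -/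
def softSimplices (G : SimpleGraph V) (m : ℕ) (S : Set V) : Set (Finset V) :=
  {z | z.Nonempty ∧ G.IsClique (z : Set V) ∧ ↑z ⊆ S ∧ z.card ≠ m}

theorem sphOn_softSimplices_inter_of_card_lt [Finite V] {m : ℕ} {S : Set V} (hS : MfdOn G m S)
    (ih : ∀ k, 1 ≤ k → k < m → ∀ T, SphOn G (k + 1) T →
      SphOn (softGraph V k) (k + 1) (softSimplices G k T))
    {z : Finset V} (hz : z ∈ softSimplices G m S) (hzm : z.card < m) :
    SphOn (softGraph V m) m (softSimplices G m S ∩ (softGraph V m).neighborSet z) := by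
  obtain ⟨hne, hzc, hzS, -⟩ := hz
  have hpos := Finset.card_pos.2 hne
  obtain ⟨k, hk, hl⟩ := hS.link hzc hzS hne
  obtain ⟨k, rfl⟩ : ∃ j, k = j + 1 := ⟨k - 1, by omega⟩
  have hlow : SphOn (softGraph V m) (z.card - 1) {x | x.Nonempty ∧ x ⊂ z} :=
    sphOn_boundary (by omega) (by omega)
  have hdis : ∀ u ∈ softSimplices G k (commonLink G S z), Disjoint z u := fun u hu =>
    Finset.disjoint_right.2 fun x hx => notMem_of_mem_commonLink (hu.2.2.1 hx)
  have hup := (ih k (by omega) (by omega) _ hl).map (H := softGraph V m) (z ∪ ·) ?_ ?_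
  · have hj := hlow.join hup ?_
    · rw [show z.card - 1 + (k + 1) = m by omega] at hj
      convert hj using 1
      ext y
      constructor
      · rintro ⟨⟨hy, hyc, hyS, hym⟩, hzy⟩
        rcases hzy with h | h | h
        · have hun := Finset.union_sdiff_of_subset h.1
          refine .inr ⟨y \ z, ⟨Finset.sdiff_nonempty.2 h.2, hyc.subset (by simp), ?_, ?_⟩, hun⟩
          · intro u hu
            obtain ⟨huy, huz⟩ := Finset.mem_sdiff.1 hu
            exact ⟨hyS huy, fun x hx => hyc (h.1 hx) huy (by rintro rfl; exact huz hx)⟩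
          · have := Finset.card_sdiff_of_subset h.1
            have := Finset.card_le_card h.1
            omega
        · exact .inl ⟨hy, h⟩
        · have := h.2.1
          omega
      · rintro (⟨hy, hyz⟩ | ⟨u, hu, rfl⟩)
        · have := Finset.card_lt_card hyz
          exact ⟨⟨hy, hzc.subset hyz.1, (Finset.coe_subset.2 hyz.1).trans hzS, by omega⟩,
            .inr (.inl hyz)⟩
        · have hd := hdis u hu
          obtain ⟨⟨w, hw⟩, huc, huS, hum⟩ := hu
          refine ⟨⟨hne.mono Finset.subset_union_left, ?_, ?_, ?_⟩, .inl ?_⟩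
          · intro x hx y hy hxy
            rcases Finset.mem_union.1 hx with hx | hx <;> rcases Finset.mem_union.1 hy with hy | hy
            · exact hzc hx hy hxy
            · exact (huS hy).2 x hx
            · exact ((huS hx).2 y hy).symm
            · exact huc hx hy hxy
          · rw [Finset.coe_union]
            exact Set.union_subset hzS fun x hx => (huS hx).1
          · change (z ∪ u).card ≠ m
            rw [Finset.card_union_of_disjoint hd]
            omega
          · exact Finset.ssubset_def.2 ⟨Finset.subset_union_left, fun h =>
              Finset.disjoint_right.1 hd hw (h (Finset.mem_union_right z hw))⟩
    · rintro a ⟨-, ha⟩ _ ⟨u, -, rfl⟩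
      exact .inl (ha.trans_subset Finset.subset_union_left)
  · intro a ha b hb hab
    have := congrArg (· \ z) hab
    simpa only [Finset.union_sdiff_cancel_left (hdis a ha),
      Finset.union_sdiff_cancel_left (hdis b hb)] using this
  · exact fun a ha b hb => softGraph_union_adj (hdis a ha) (hdis b hb) (by omega)

theorem sphOn_softSimplices_inter_of_facet [Finite V] {m : ℕ} (hm : 1 ≤ m) {S : Set V}
    (hS : MfdOn G m S) {z : Finset V} (hz : z ∈ softSimplices G m S) (hzm : z.card = m + 1) :
    SphOn (softGraph V m) m (softSimplices G m S ∩ (softGraph V m).neighborSet z) := by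
  obtain ⟨hne, hzc, hzS, -⟩ := hz
  have hcases : ∀ y ∈ softSimplices G m S ∩ (softGraph V m).neighborSet z,
      (y.Nonempty ∧ y.card < m ∧ y ⊂ z) ∨ (G.IsClique (y : Set V) ∧ ↑y ⊆ S ∧ y.card = m + 1 ∧
        (y ∩ z).card = m ∧ y ≠ z) := by
    rintro y ⟨⟨hy, hyc, hyS, hym⟩, hzy⟩
    have hzy : (softGraph V m).Adj z y := hzy
    have hle := hS.card_le hyc hyS
    have hne := hzy.ne'
    rcases hzy with h | h | h
    · have := Finset.card_lt_card h
      omega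
    · have := Finset.card_lt_card h
      exact .inl ⟨hy, by omega, h⟩
    · exact .inr ⟨hyc, hyS, h.2.2.1, by rw [Finset.inter_comm]; exact h.2.2.2, hne⟩
  have himage : (· ∩ z) '' (softSimplices G m S ∩ (softGraph V m).neighborSet z) =
      {x | x.Nonempty ∧ x ⊂ z} := by
    ext x
    constructor
    · rintro ⟨y, hy, rfl⟩
      change (y ∩ z).Nonempty ∧ y ∩ z ⊂ z
      rcases hcases y hy with ⟨h1, h2, h3⟩ | ⟨h1, h2, h3, h4, h5⟩
      · rw [Finset.inter_eq_left.2 h3.1]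
        exact ⟨h1, h3⟩
      · refine ⟨Finset.card_pos.1 (by omega),
          Finset.ssubset_iff_subset_ne.2 ⟨Finset.inter_subset_right, fun h => ?_⟩⟩
        rw [h] at h4
        omega
    · rintro ⟨hx, hxz⟩
      by_cases hxm : x.card = m
      · obtain ⟨q, hq, hqS, hqm, hqz⟩ := hS.exists_opposite hm hxm hzc hzS hzm hxz.1
        refine ⟨q, ⟨⟨Finset.card_pos.1 (by omega), hq, hqS, by omega⟩, .inr (.inr ⟨?_, hzm, hqm, ?_⟩)⟩,
          hqz⟩
        · rintro rfl
          rw [Finset.inter_self] at hqz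
          exact hxz.ne hqz.symm
        · rw [Finset.inter_comm, hqz, hxm]
      · exact ⟨x, ⟨⟨hx, hzc.subset hxz.1, (Finset.coe_subset.2 hxz.1).trans hzS, hxm⟩,
          .inr (.inl hxz)⟩, Finset.inter_eq_left.2 hxz.1⟩
  refine SphOn.of_map (H := softGraph V m) (· ∩ z) ?_ ?_ ?_
  · rw [himage]
    exact sphOn_boundary hzm le_rfl
  · intro x hx y hy hxy
    have hxy : x ∩ z = y ∩ z := hxy
    rcases hcases x hx with ⟨-, h2, h3⟩ | ⟨h1, h2, h3, h4, h5⟩ <;>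
      rcases hcases y hy with ⟨-, k2, k3⟩ | ⟨k1, k2, k3, k4, k5⟩
    · rwa [Finset.inter_eq_left.2 h3.1, Finset.inter_eq_left.2 k3.1] at hxy
    · rw [Finset.inter_eq_left.2 h3.1] at hxy
      rw [hxy] at h2
      omega
    · rw [Finset.inter_eq_left.2 k3.1] at hxy
      rw [← hxy] at k2
      omega
    · exact hS.facet_unique hm h4 hzc hzS hzm Finset.inter_subset_right h1 h2 h3
        Finset.inter_subset_left k1 k2 k3 (hxy ▸ Finset.inter_subset_left) h5 k5
  · have hlow : ∀ x y : Finset V, (softGraph V m).Adj x y → (x.card < m + 1 ∨ y.card < m + 1) →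
        x ⊂ y ∨ y ⊂ x := by
      rintro x y (h | h | h) hc
      · exact .inl h
      · exact .inr h
      · omega
    have hmixed : ∀ x y : Finset V, x ⊂ z → x.card < m → y.card = m + 1 → (y ∩ z).card = m →
        ((softGraph V m).Adj x y ↔ (softGraph V m).Adj x (y ∩ z)) := by
      intro x y hxz hx hy hyz
      constructor
      · intro h
        rcases hlow x y h (by omega) with h | h
        · refine .inl (Finset.ssubset_iff_subset_ne.2 ⟨Finset.subset_inter h.1 hxz.1, ?_⟩)
          rintro rfl
          omega
        · have := Finset.card_lt_card h
          omega
      · intro h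
        rcases hlow x _ h (by omega) with h | h
        · exact .inl (h.trans_subset Finset.inter_subset_left)
        · have := Finset.card_lt_card h
          omega
    intro x hx y hy
    rcases hcases x hx with ⟨-, h2, h3⟩ | ⟨h1, h2, h3, h4, h5⟩ <;>
      rcases hcases y hy with ⟨-, k2, k3⟩ | ⟨k1, k2, k3, k4, k5⟩
    · rw [Finset.inter_eq_left.2 h3.1, Finset.inter_eq_left.2 k3.1]
    · rw [Finset.inter_eq_left.2 h3.1]
      exact hmixed x y h3 h2 k3 k4
    · rw [Finset.inter_eq_left.2 k3.1, SimpleGraph.adj_comm,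
        SimpleGraph.adj_comm _ (x ∩ z)]
      exact hmixed y x k3 k2 h3 h4
    · constructor
      · intro h
        have := hS.not_adj_of_adj_facet hm hzc hzS hzm h1 h2 h3 h4 k1 k2 k3 k4 h.ne
        rcases h with h | h | h
        · have := Finset.card_lt_card h
          omega
        · have := Finset.card_lt_card h
          omega
        · exact (this h.2.2.2).elim
      · intro h
        rcases hlow _ _ h (by omega) with h | h
        · have := Finset.card_lt_card h
          omega
        · have := Finset.card_lt_card h
          omega

theorem mem_softSimplices_one {S : Set V} (hS : MfdOn G 1 S) {z : Finset V} :
    z ∈ softSimplices G 1 S ↔ ∃ x ∈ S, ∃ y ∈ S, G.Adj x y ∧ z = {x, y} := by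
  constructor
  · rintro ⟨hz, hzc, hzS, hz1⟩
    have := Finset.card_pos.2 hz
    have := hS.card_le hzc hzS
    obtain ⟨x, y, hxy, rfl⟩ := Finset.card_eq_two.1 (show z.card = 2 by omega)
    exact ⟨x, hzS (by simp), y, hzS (by simp), hzc (by simp) (by simp) hxy, rfl⟩
  · rintro ⟨x, hx, y, hy, hxy, rfl⟩
    refine ⟨by simp, ?_, ?_, ?_⟩
    · rw [Finset.coe_pair, SimpleGraph.isClique_pair]
      exact fun _ => hxy
    · rw [Finset.coe_pair]
      exact Set.pair_subset hx hy
    · rw [Finset.card_pair hxy.ne]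
      omega

theorem exists_contrOn_softSimplices_one [Finite V] {S : Set V} (hS : SphOn G 2 S) :
    ∃ z ∈ softSimplices G 1 S, ContrOn (softGraph V 1) (softSimplices G 1 S \ {z}) := by
  obtain ⟨hM, v, hv, hc⟩ := hS
  replace hM : MfdOn G 1 S := hM
  obtain ⟨a, a', haa', hadj, hv'⟩ := (hM v hv).eq_pair
  have ha : a ∈ S ∩ G.neighborSet v := hv' ▸ by simp
  have ha' : a' ∈ S ∩ G.neighborSet v := hv' ▸ by simp
  have hva : G.Adj v a := ha.2
  have hva' : G.Adj v a' := ha'.2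
  have hnbr : ∀ x ∈ S, G.Adj v x → x = a ∨ x = a' := fun x hx hvx =>
    (hv' ▸ ⟨hx, hvx⟩ : x ∈ ({a, a'} : Set V))
  obtain ⟨c, hcS, hcv, hca', hcuniq⟩ : ∃ c ∈ S, c ≠ v ∧ G.Adj a' c ∧
      ∀ x ∈ S, x ≠ v → G.Adj a' x → x = c := by
    obtain ⟨p, r, hpr, -, h⟩ := (hM a' ha'.1).eq_pair
    have hvm : v ∈ S ∩ G.neighborSet a' := ⟨hv, hva'.symm⟩
    have hp : p ∈ S ∩ G.neighborSet a' := h ▸ by simp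
    have hr : r ∈ S ∩ G.neighborSet a' := h ▸ by simp
    have hall : ∀ x ∈ S, G.Adj a' x → x = p ∨ x = r := fun x hx hxa =>
      (h ▸ ⟨hx, hxa⟩ : x ∈ ({p, r} : Set V))
    rcases hall v hv hva'.symm with rfl | rfl
    · exact ⟨r, hr.1, hpr.symm, hr.2, fun x hx hxv hxa => (hall x hx hxa).resolve_left hxv⟩
    · exact ⟨p, hp.1, hpr, hp.2, fun x hx hxv hxa => (hall x hx hxa).resolve_right hxv⟩
  have hX := contrOn_softNhd le_rfl hM hc Set.sdiff_subset
    (fun _ => ⟨a, ⟨ha.1, hva.ne'⟩, a', ⟨ha'.1, hva'.ne'⟩, haa'⟩)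
  have hXmem : ∀ z, z ∈ softNhd G 1 S (S \ {v}) ↔
      ∃ x ∈ S \ {v}, ∃ y ∈ S \ {v}, G.Adj x y ∧ z = {x, y} := fun z =>
    mem_softNhd_one Set.sdiff_subset
  have hXv : ∀ z ∈ softNhd G 1 S (S \ {v}), v ∉ z := by
    intro z hz hvz
    obtain ⟨x, hx, y, hy, -, rfl⟩ := (hXmem z).1 hz
    rcases Finset.mem_insert.1 hvz with h | h
    · exact hx.2 h.symm
    · exact hy.2 (Finset.mem_singleton.1 h).symm
  refine ⟨{v, a}, (mem_softSimplices_one hM).2 ⟨v, hv, a, ha.1, hva, rfl⟩, ?_⟩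
  have heq : softSimplices G 1 S \ {{v, a}} = insert {v, a'} (softNhd G 1 S (S \ {v})) := by
    ext z
    rw [Set.mem_sdiff, mem_softSimplices_one hM, Set.mem_insert_iff, hXmem, Set.mem_singleton_iff]
    constructor
    · rintro ⟨⟨x, hx, y, hy, hxy, rfl⟩, hne⟩
      by_cases hxv : x = v
      · subst hxv
        rcases hnbr y hy hxy with rfl | rfl
        · exact (hne rfl).elim
        · exact .inl rfl
      by_cases hyv : y = v
      · subst hyv
        rcases hnbr x hx hxy.symm with rfl | rfl
        · exact (hne (Finset.pair_comm _ _)).elim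
        · exact .inl (Finset.pair_comm _ _)
      exact .inr ⟨x, ⟨hx, hxv⟩, y, ⟨hy, hyv⟩, hxy, rfl⟩
    · rintro (rfl | ⟨x, hx, y, hy, hxy, rfl⟩)
      · refine ⟨⟨v, hv, a', ha'.1, hva', rfl⟩, fun h => ?_⟩
        have : a ∈ ({v, a'} : Finset V) := h ▸ by simp
        rcases Finset.mem_insert.1 this with h | h
        · exact hva.ne h.symm
        · exact haa' (Finset.mem_singleton.1 h)
      · refine ⟨⟨x, hx.1, y, hy.1, hxy, rfl⟩, fun h => ?_⟩
        exact hXv _ ((hXmem _).2 ⟨x, hx, y, hy, hxy, rfl⟩) (h ▸ by simp)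
  rw [heq]
  refine hX.insert_vertex (fun h => hXv _ h (by simp)) ?_
  have : softNhd G 1 S (S \ {v}) ∩ (softGraph V 1).neighborSet {v, a'} = {{a', c}} := by
    refine Set.eq_singleton_iff_unique_mem.2 ⟨⟨(hXmem _).2
      ⟨a', ⟨ha'.1, hva'.ne'⟩, c, ⟨hcS, hcv⟩, hca', rfl⟩, ?_⟩, ?_⟩
    · refine (softGraph_one_adj (Finset.card_pair hva'.ne) (Finset.card_pair hca'.ne)).2
        ⟨fun h => ?_, a', by simp⟩
      have : v ∈ ({a', c} : Finset V) := h ▸ by simp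
      rcases Finset.mem_insert.1 this with h | h
      · exact hva'.ne h
      · exact hcv (Finset.mem_singleton.1 h).symm
    · rintro z ⟨hz, hvz⟩
      have hvz : (softGraph V 1).Adj {v, a'} z := hvz
      have hvz' := hXv z hz
      obtain ⟨x, hx, y, hy, hxy, rfl⟩ := (hXmem z).1 hz
      obtain ⟨-, w, hw⟩ := (softGraph_one_adj (Finset.card_pair hva'.ne)
        (Finset.card_pair hxy.ne)).1 hvz
      obtain ⟨hw1, hw2⟩ := Finset.mem_inter.1 hw
      have hwa : w = a' := by
        rcases Finset.mem_insert.1 hw1 with rfl | h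
        · exact (hvz' hw2).elim
        · exact Finset.mem_singleton.1 h
      subst hwa
      rcases Finset.mem_insert.1 hw2 with rfl | h
      · rw [hcuniq y hy.1 hy.2 hxy]
      · obtain rfl := Finset.mem_singleton.1 h
        rw [hcuniq x hx.1 hx.2 hxy.symm, Finset.pair_comm]
  rw [this]
  exact .single _

theorem exists_contrOn_softSimplices [Finite V] {m : ℕ} (hm : 2 ≤ m) {S : Set V}
    (hS : SphOn G (m + 1) S) :
    ∃ z ∈ softSimplices G m S, ContrOn (softGraph V m) (softSimplices G m S \ {z}) := by
  obtain ⟨hM, v, hv, hc⟩ := hS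
  replace hM : MfdOn G m S := hM
  refine ⟨{v}, ⟨by simp, by simp, by simpa using hv, by simp; omega⟩, ?_⟩
  have hX := contrOn_softNhd (by omega) hM hc Set.sdiff_subset (fun h => by omega)
  have := hX.union_star (R := lowStar G m S v) v ?_ ?_
  · convert this using 1
    ext z
    constructor
    · rintro ⟨⟨hz, hzc, hzS, hzm⟩, hzv⟩
      have hle := hM.card_le hzc hzS
      by_cases hlt : z.card < m
      · by_cases hvz : v ∈ z
        · refine .inr ⟨hzc, hzS, hvz, ?_, hlt⟩
          by_contra h
          have := Finset.card_pos.2 hz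
          obtain ⟨u, rfl⟩ := Finset.card_eq_one.1 (show z.card = 1 by omega)
          exact hzv (by rw [Finset.mem_singleton.1 hvz]; rfl)
        · exact .inl ⟨hz, hzc, .inl ⟨fun u hu => ⟨hzS hu, fun h => hvz (h ▸ hu)⟩, hlt⟩⟩
      · refine .inl ⟨hz, hzc, .inr ⟨hzS, by omega, ?_⟩⟩
        have hce : 1 < (z.erase v).card := by
          have := Finset.pred_card_le_card_erase (s := z) (a := v)
          omega
        obtain ⟨x, hx, y, hy, hxy⟩ := Finset.one_lt_card.1 hce
        have key : ∀ x ∈ z.erase v, x ∈ (z : Set V) ∩ (S \ {v}) := fun x hx =>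
          ⟨Finset.mem_of_mem_erase hx, hzS (Finset.mem_of_mem_erase hx), Finset.ne_of_mem_erase hx⟩
        exact ⟨x, key x hx, y, key y hy, hxy⟩
    · rintro (⟨hz, hzc, ⟨hzS, hzm⟩ | ⟨hzS, hzm, -⟩⟩ | ⟨hzc, hzS, hvz, hz2, hzm⟩)
      · exact ⟨⟨hz, hzc, hzS.trans Set.sdiff_subset, hzm.ne⟩, by
          rintro rfl
          exact (hzS (by simp : v ∈ (({v} : Finset V) : Set V))).2 rfl⟩
      · exact ⟨⟨hz, hzc, hzS, by omega⟩, by rintro rfl; simp at hzm; omega⟩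
      · exact ⟨⟨⟨v, hvz⟩, hzc, hzS, hzm.ne⟩, by rintro rfl; simp at hz2⟩
  · rintro q ⟨-, -, ⟨hq, -⟩ | ⟨-, hq, -⟩⟩ hvq
    · exact absurd rfl (hq hvq).2
    · omega
  · rintro p ⟨hpc, hpS, hvp, hp2, hpm⟩
    have := Finset.card_erase_of_mem hvp
    exact ⟨hvp, hpm.le, Finset.card_pos.1 (by omega), hpc.subset (by simp), .inl ⟨fun u hu =>
      ⟨hpS (Finset.mem_of_mem_erase hu), Finset.ne_of_mem_erase hu⟩, by omega⟩⟩

theorem mfdOn_softSimplices_of_forall [Finite V] {m : ℕ} (hm : 1 ≤ m) {S : Set V}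
    (hS : MfdOn G m S)
    (ih : ∀ k, 1 ≤ k → k < m → ∀ T, SphOn G (k + 1) T →
      SphOn (softGraph V k) (k + 1) (softSimplices G k T)) :
    MfdOn (softGraph V m) m (softSimplices G m S) := by
  intro z hz
  have hle := hS.card_le hz.2.1 hz.2.2.1
  have hne := hz.2.2.2
  by_cases h : z.card < m
  · exact sphOn_softSimplices_inter_of_card_lt hS ih hz h
  · exact sphOn_softSimplices_inter_of_facet hm hS hz (by omega)

theorem sphOn_softSimplices [Finite V] {m : ℕ} (hm : 1 ≤ m) {S : Set V}
    (hS : SphOn G (m + 1) S) : SphOn (softGraph V m) (m + 1) (softSimplices G m S) := by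
  induction m using Nat.strong_induction_on generalizing S with
  | _ m ih =>
  refine ⟨mfdOn_softSimplices_of_forall hm hS.1 fun k hk hkm T hT => ih k hkm hk hT, ?_⟩
  rcases hm.eq_or_lt with rfl | hm
  · exact exists_contrOn_softSimplices_one hS
  · exact exists_contrOn_softSimplices hm hS

theorem mfdOn_softSimplices [Finite V] {m : ℕ} (hm : 1 ≤ m) {S : Set V}
    (hS : MfdOn G m S) : MfdOn (softGraph V m) m (softSimplices G m S) :=
  mfdOn_softSimplices_of_forall hm hS fun _ hk _ _ hT => sphOn_softSimplices hk hT

end SoftSphere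

section SoftBary

theorem isGraphManifold_iff_mfdOn {V U : Type} [Finite V] {H : SimpleGraph V}
    {G : SimpleGraph U} (q : ℕ) (f : H ↪g G) :
    IsGraphManifold q H ↔ Nonempty V ∧ MfdOn G q (Set.range f) := by
  refine and_congr_right fun _ => ?_
  rw [MfdOn, Set.forall_mem_range]
  refine forall_congr' fun v => ?_
  rw [isSphere_iff_sphOn q (f.comp (SimpleGraph.Embedding.induce (H.neighborSet v))),
    range_induce_neighborSet]

variable {V : Type}

theorem MfdOn.ncard_facets [DecidableEq V] {G : SimpleGraph V} {q : ℕ}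
    (hG : MfdOn G q Set.univ) (hq : 1 ≤ q) {s : Finset V} (hs : G.IsNClique q s) :
    {t : Finset V | G.IsNClique (q + 1) t ∧ s ⊆ t}.ncard = 2 := by
  obtain ⟨a, b, hab, -, h⟩ := hG.link_pair hq hs.1 (Set.subset_univ _) hs.2
  have ha : a ∈ commonLink G Set.univ s := h ▸ by simp
  have hb : b ∈ commonLink G Set.univ s := h ▸ by simp
  have has := notMem_of_mem_commonLink ha
  have hbs := notMem_of_mem_commonLink hb
  have : {t : Finset V | G.IsNClique (q + 1) t ∧ s ⊆ t} = {insert a s, insert b s} := by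
    ext t
    constructor
    · rintro ⟨ht, hst⟩
      obtain ⟨c, hc, -, rfl⟩ := exists_insert_of_card ht.1 (Set.subset_univ _) hst
        (by rw [ht.2, hs.2])
      rw [h] at hc
      rcases hc with rfl | rfl
      · exact .inl rfl
      · exact .inr rfl
    · rintro (rfl | rfl)
      · exact ⟨⟨isClique_insert_of_mem_commonLink hs.1 ha, by
          rw [Finset.card_insert_of_notMem has, hs.2]⟩, Finset.subset_insert _ _⟩
      · exact ⟨⟨isClique_insert_of_mem_commonLink hs.1 hb, by
          rw [Finset.card_insert_of_notMem hbs, hs.2]⟩, Finset.subset_insert _ _⟩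
  rw [this, Set.ncard_pair]
  intro e
  have : a ∈ insert b s := e ▸ Finset.mem_insert_self a s
  rcases Finset.mem_insert.1 this with h | h
  · exact hab h
  · exact has h

theorem MfdOn.softVerts_eq [DecidableEq V] {G : SimpleGraph V} {q : ℕ}
    (hG : MfdOn G q Set.univ) (hq : 1 ≤ q) : softVerts G q = softSimplices G q Set.univ := by
  ext s
  constructor
  · rintro ⟨hs, hsc, h | h⟩
    · exact ⟨hs, hsc, Set.subset_univ _, h⟩
    · have h1 := hG.ncard_facets hq h.1
      rw [h.2] at h1
      omega
  · rintro ⟨hs, hsc, -, h⟩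
    exact ⟨hs, hsc, .inl h⟩

theorem MfdOn.softBary_adj {G : SimpleGraph V} {q : ℕ}
    (hG : MfdOn G q Set.univ) (hq : 1 ≤ q) (a b : softVerts G q) :
    letI := Classical.decEq V
    (softGraph V q).Adj a b ↔ (softBary G q).Adj a b := by
  let := Classical.decEq V
  have hfacet : ∀ a b : softVerts G q, (G.IsNClique (q + 1) (a : Finset V) ∧
      G.IsNClique (q + 1) (b : Finset V) ∧ IsInteriorFace G q ((a : Finset V) ∩ (b : Finset V))) ↔
      ((a : Finset V).card = q + 1 ∧ (b : Finset V).card = q + 1 ∧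
        ((a : Finset V) ∩ (b : Finset V)).card = q) := by
    intro a b
    constructor
    · exact fun h => ⟨h.1.2, h.2.1.2, h.2.2.1.2⟩
    · rintro ⟨h1, h2, h3⟩
      have hs : G.IsNClique q ((a : Finset V) ∩ (b : Finset V)) :=
        ⟨a.2.2.1.subset (Finset.coe_subset.2 Finset.inter_subset_left), h3⟩
      exact ⟨⟨a.2.2.1, h1⟩, ⟨b.2.2.1, h2⟩, hs, hG.ncard_facets hq hs⟩
  rw [softBary, SimpleGraph.fromRel_adj, hfacet a b, hfacet b a, softGraph_adj,
    Finset.inter_comm (b : Finset V) a]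
  have hss : (a : Finset V) ⊂ b → a ≠ b := fun h e => h.ne (congrArg _ e)
  have hss' : (b : Finset V) ⊂ a → a ≠ b := fun h e => h.ne (congrArg _ e.symm)
  have hne : (a : Finset V) ≠ b ↔ a ≠ b := Subtype.coe_injective.ne_iff
  tauto

end SoftBary

theorem stmt0 {V : Type} [Fintype V] (q : ℕ) (hq : 1 ≤ q) (G : SimpleGraph V)
    (hG : IsGraphManifold q G) : IsGraphManifold q (softBary G q) := by
  let := Classical.decEq V
  obtain ⟨⟨v⟩, hM⟩ := (isGraphManifold_iff_mfdOn q (SimpleGraph.Embedding.refl (G := G))).1 hG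
  replace hM : MfdOn G q Set.univ := by
    convert hM
    exact Set.range_id.symm
  have hS : MfdOn (softGraph V q) q (softVerts G q) :=
    hM.softVerts_eq hq ▸ mfdOn_softSimplices hq hM
  let f : softBary G q ↪g softGraph V q :=
    ⟨⟨Subtype.val, Subtype.val_injective⟩, hM.softBary_adj hq _ _⟩
  refine (isGraphManifold_iff_mfdOn q f).2 ⟨?_, ?_⟩
  · rw [hM.softVerts_eq hq]
    rcases hq.eq_or_lt with rfl | hq
    · obtain ⟨u, hu⟩ := (hM v trivial).2
      exact ⟨⟨_, (mem_softSimplices_one hM).2 ⟨v, trivial, u, trivial, hu.1.2, rfl⟩⟩⟩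
    · exact ⟨⟨{v}, by simp, by simp, Set.subset_univ _, by simp; omega⟩⟩
  · convert hS
    exact Subtype.range_val
end

section
/- Let G and H be simple graphs on the same finite vertex set of n vertices, with Kirchhoff Laplacian eigenvalues lambda_1(G) <= ... <= lambda_n(G) and lambda_1(H) <= ... <= lambda_n(H), both sorted in increasing order. Then sum_{k=1}^n |lambda_k(G) - lambda_k(H)| <= 4 d(G,H), where d(G,H) is the number of edges in the symmetric difference of the edge sets of G and H; equivalently, the spectral functions satisfy ||F_G - F_H||_{L^1([0,1])} <= 4 d(G,H)/n. -/
open SimpleGraph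


section SpectralMonotonicity

open scoped InnerProductSpace

namespace LinearMap.IsSymmetric

variable {𝕜 E : Type*} [RCLike 𝕜] [NormedAddCommGroup E] [InnerProductSpace 𝕜 E]
  [FiniteDimensional 𝕜 E] {T S : E →ₗ[𝕜] E} {n : ℕ}

theorem re_inner_apply_self_eq_sum (hT : T.IsSymmetric) (hn : Module.finrank 𝕜 E = n) (x : E) :
    RCLike.re ⟪T x, x⟫_𝕜 =
      ∑ i, hT.eigenvalues hn i * ‖(hT.eigenvectorBasis hn).repr x i‖ ^ 2 := by
  rw [← (hT.eigenvectorBasis hn).repr.inner_map_map, PiLp.inner_apply, map_sum]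
  refine Finset.sum_congr rfl fun i _ => ?_
  rw [hT.eigenvectorBasis_apply_self_apply hn x i, RCLike.inner_apply, map_mul (starRingEnd 𝕜),
    RCLike.conj_ofReal, mul_left_comm, RCLike.mul_conj]
  norm_cast

/-- **Weyl's monotonicity theorem**: the sorted eigenvalues of a symmetric operator are monotone
in its quadratic form. -/
theorem eigenvalues_le_eigenvalues (hT : T.IsSymmetric) (hS : S.IsSymmetric)
    (hn : Module.finrank 𝕜 E = n) (h : ∀ x, RCLike.re ⟪T x, x⟫_𝕜 ≤ RCLike.re ⟪S x, x⟫_𝕜)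
    (k : Fin n) : hT.eigenvalues hn k ≤ hS.eigenvalues hn k := by
  set b := hT.eigenvectorBasis hn
  set c := hS.eigenvectorBasis hn
  let f : E →ₗ[𝕜] ({i : Fin n // i ≠ k} → 𝕜) :=
    LinearMap.pi fun i =>
      if i.1 < k then c.toBasis.coord i else b.toBasis.coord i
  have hker : LinearMap.ker f ≠ ⊥ := by
    refine LinearMap.ker_ne_bot_of_finrank_lt ?_
    rw [Module.finrank_fintype_fun_eq_card, hn, Fintype.card_subtype_compl, Fintype.card_fin,
      Fintype.card_subtype_eq]
    have := k.pos
    omega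
  obtain ⟨x, hx, hx0⟩ := Submodule.exists_mem_ne_zero_of_ne_bot hker
  have hcoord (i : Fin n) (hi : i ≠ k) :
      (if i < k then c.toBasis.coord i else b.toBasis.coord i) x = 0 :=
    congrFun (LinearMap.mem_ker.mp hx) ⟨i, hi⟩
  have hc (i : Fin n) (hi : i < k) : c.repr x i = 0 := by
    simpa [hi] using hcoord i hi.ne
  have hb (i : Fin n) (hi : k < i) : b.repr x i = 0 := by
    simpa [hi.not_gt] using hcoord i hi.ne'
  have hsum (e : OrthonormalBasis (Fin n) 𝕜 E) : ‖x‖ ^ 2 = ∑ i, ‖e.repr x i‖ ^ 2 := by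
    rw [← e.repr.norm_map x, EuclideanSpace.norm_sq_eq]
  have hlow : hT.eigenvalues hn k * ‖x‖ ^ 2 ≤ RCLike.re ⟪T x, x⟫_𝕜 := by
    rw [hT.re_inner_apply_self_eq_sum hn, hsum b, Finset.mul_sum]
    refine Finset.sum_le_sum fun i _ => ?_
    rcases le_or_gt i k with hi | hi
    · exact mul_le_mul_of_nonneg_right (hT.eigenvalues_antitone hn hi) (sq_nonneg _)
    · simp [b, hb i hi]
  have hupp : RCLike.re ⟪S x, x⟫_𝕜 ≤ hS.eigenvalues hn k * ‖x‖ ^ 2 := by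
    rw [hS.re_inner_apply_self_eq_sum hn, hsum c, Finset.mul_sum]
    refine Finset.sum_le_sum fun i _ => ?_
    rcases le_or_gt k i with hi | hi
    · exact mul_le_mul_of_nonneg_right (hS.eigenvalues_antitone hn hi) (sq_nonneg _)
    · simp [c, hc i hi]
  exact le_of_mul_le_mul_right ((hlow.trans (h x)).trans hupp) (by positivity)

end LinearMap.IsSymmetric

theorem Matrix.IsHermitian.eigenvalues₀_le_eigenvalues₀ {ι : Type*} [Fintype ι] [DecidableEq ι]
    {A B : Matrix ι ι ℝ} (hA : A.IsHermitian) (hB : B.IsHermitian)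
    (h : ∀ x : ι → ℝ, x ⬝ᵥ A.mulVec x ≤ x ⬝ᵥ B.mulVec x) (k : Fin (Fintype.card ι)) :
    hA.eigenvalues₀ k ≤ hB.eigenvalues₀ k := by
  refine LinearMap.IsSymmetric.eigenvalues_le_eigenvalues _ _ _ (fun x => ?_) k
  simpa [EuclideanSpace.inner_eq_star_dotProduct, Matrix.toLpLin_apply] using h x.ofLp

end SpectralMonotonicity

section LaplacianSpectrum

variable {V : Type} [Fintype V] [DecidableEq V]

theorem eigList_eq_ofFn (G : SimpleGraph V) [DecidableRel G.Adj] :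
    eigList G = List.ofFn fun i => (lapHerm G).eigenvalues₀ i.rev := by
  have hperm : Finset.univ.val.map (lapHerm G).eigenvalues =
      (List.ofFn fun i => (lapHerm G).eigenvalues₀ i.rev : Multiset ℝ) := by
    have h₁ : Finset.univ.val.map (lapHerm G).eigenvalues =
        Finset.univ.val.map (lapHerm G).eigenvalues₀ := by
      have h := (lapHerm G).roots_charpoly_eq_eigenvalues.symm.trans
        (lapHerm G).roots_charpoly_eq_eigenvalues₀
      simpa [Function.comp_def] using h
    have h₂ := Multiset.map_univ_val_equiv (Fin.revPerm (n := Fintype.card V))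
    rw [h₁, ← h₂, Multiset.map_map, Fin.univ_val_map]
    rfl
  rw [eigList, hperm, Multiset.coe_sort]
  apply List.mergeSort_of_pairwise
  simp_rw [decide_eq_true_eq, ← List.sortedLE_iff_pairwise]
  refine Monotone.sortedLE_ofFn fun i j hij => ?_
  exact (lapHerm G).eigenvalues₀_antitone (Fin.rev_le_rev.mpr hij)

theorem length_eigList (G : SimpleGraph V) [DecidableRel G.Adj] :
    (eigList G).length = Fintype.card V := by
  rw [eigList_eq_ofFn, List.length_ofFn]

/-- The Laplacian eigenvalues are monotone under adding edges. -/
theorem eigList_getD_mono {G H : SimpleGraph V} [DecidableRel G.Adj] [DecidableRel H.Adj]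
    (h : G ≤ H) (k : ℕ) : (eigList G).getD k 0 ≤ (eigList H).getD k 0 := by
  simp only [eigList_eq_ofFn, List.getD_eq_getElem?_getD, List.getElem?_ofFn]
  split_ifs
  · refine (lapHerm G).eigenvalues₀_le_eigenvalues₀ (lapHerm H) (fun x => ?_) _
    simp only [← Matrix.toLinearMap₂'_apply', SimpleGraph.lapMatrix_toLinearMap₂']
    gcongr with i _ j _
    split_ifs with hG hH hH
    · rfl
    · exact absurd (h hG) hH
    · positivity
    · rfl
  · rfl

theorem sum_eigList_getD (G : SimpleGraph V) [DecidableRel G.Adj] [Fintype G.edgeSet] :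
    ∑ k ∈ Finset.range (Fintype.card V), (eigList G).getD k 0 = 2 * (G.edgeFinset.card : ℝ) := by
  have hsum : ∑ k ∈ Finset.range (Fintype.card V), (eigList G).getD k 0 = (eigList G).sum := by
    rw [← length_eigList G, Finset.sum_range, ← Fin.sum_univ_getElem]
    simp
  rw [hsum, ← Multiset.sum_coe, eigList, Multiset.sort_eq, ← Finset.sum]
  have htrace := (lapHerm G).trace_eq_sum_eigenvalues
  simp only [RCLike.ofReal_real_eq_id, id] at htrace
  rw [← htrace, Matrix.trace]
  simp only [SimpleGraph.lapMatrix, SimpleGraph.degMatrix, Matrix.diag_apply, Matrix.sub_apply,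
    Matrix.diagonal_apply_eq, SimpleGraph.adjMatrix_apply, G.irrefl, if_false, sub_zero]
  have hdeg : ∑ v, G.degree v = 2 * G.edgeFinset.card := by
    convert G.sum_degrees_eq_twice_card_edges
  exact_mod_cast hdeg

theorem two_mul_card_edgeFinset_sup (G H : SimpleGraph V) [DecidableRel G.Adj]
    [DecidableRel H.Adj] :
    2 * (G ⊔ H).edgeFinset.card =
      G.edgeFinset.card + H.edgeFinset.card + graphDist G H := by
  have hd : Disjoint (G.edgeFinset \ H.edgeFinset) (H.edgeFinset \ G.edgeFinset) :=
    disjoint_sdiff_sdiff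
  rw [SimpleGraph.edgeFinset_sup, graphDist, Finset.symmDiff_def, Finset.card_union_of_disjoint hd]
  have h₁ := Finset.card_sdiff_add_card G.edgeFinset H.edgeFinset
  have h₂ := Finset.card_sdiff_add_card H.edgeFinset G.edgeFinset
  rw [Finset.union_comm] at h₂
  omega

/-- The `ℓ¹` distance of two sorted Laplacian spectra is at most twice the graph distance. -/
theorem sum_abs_eigList_sub_le (G H : SimpleGraph V) [DecidableRel G.Adj] [DecidableRel H.Adj] :
    ∑ k ∈ Finset.range (Fintype.card V), |(eigList G).getD k 0 - (eigList H).getD k 0| ≤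
      2 * (graphDist G H : ℝ) := by
  calc
    _ ≤ ∑ k ∈ Finset.range (Fintype.card V), (2 * (eigList (G ⊔ H)).getD k 0 -
        (eigList G).getD k 0 - (eigList H).getD k 0) := by
      refine Finset.sum_le_sum fun k _ => abs_le.mpr ?_
      have hG := eigList_getD_mono (le_sup_left : G ≤ G ⊔ H) k
      have hH := eigList_getD_mono (le_sup_right : H ≤ G ⊔ H) k
      constructor <;> linarith
    _ = 2 * (graphDist G H : ℝ) := by
      have hcard : 2 * ((G ⊔ H).edgeFinset.card : ℝ) =
          G.edgeFinset.card + H.edgeFinset.card + graphDist G H := by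
        exact_mod_cast two_mul_card_edgeFinset_sup G H
      rw [Finset.sum_sub_distrib, Finset.sum_sub_distrib, ← Finset.mul_sum]
      simp only [sum_eigList_getD]
      linarith

end LaplacianSpectrum

theorem specFun_fin {n : ℕ} (G : SimpleGraph (Fin n)) [DecidableRel G.Adj] (h : Finite (Fin n))
    (x : ℝ) : specFun ⟨Fin n, h, G⟩ x = (eigList G).getD (⌈(n : ℝ) * x⌉₊ - 1) 0 := by
  have hlist : gEigList ⟨Fin n, h, G⟩ = eigList G := by
    unfold gEigList
    congr!
  simp [specFun, hlist]

/-- The integral over `(0, 1]` of a step function with `n` steps of equal length. -/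
theorem integral_step_function {n : ℕ} (hn : n ≠ 0) (g : ℕ → ℝ) :
    ∫ x in Set.Ioc (0 : ℝ) 1, g (⌈(n : ℝ) * x⌉₊ - 1) = (∑ k ∈ Finset.range n, g k) / n := by
  have hn' : (0 : ℝ) < n := by positivity
  let a : ℕ → ℝ := fun k => k / n
  have ha (k : ℕ) : a k ≤ a (k + 1) := by
    simp only [a]
    gcongr
    simp
  have hconst (k : ℕ) : Set.EqOn (fun x : ℝ => g (⌈(n : ℝ) * x⌉₊ - 1)) (fun _ => g k)
      (Set.uIoc (a k) (a (k + 1))) := by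
    intro x hx
    rw [Set.uIoc_of_le (ha k), Set.mem_Ioc, div_lt_iff₀' hn', le_div_iff₀' hn'] at hx
    have hceil : ⌈(n : ℝ) * x⌉₊ = k + 1 := by
      rw [Nat.ceil_eq_iff (by simp)]
      simpa using hx
    simp [hceil]
  have hint (k : ℕ) : ∫ x in a k..a (k + 1), g (⌈(n : ℝ) * x⌉₊ - 1) = g k / n := by
    rw [intervalIntegral.integral_congr_ae (.of_forall (hconst k)), intervalIntegral.integral_const]
    simp only [a, smul_eq_mul]
    push_cast
    ring
  have hadj := intervalIntegral.sum_integral_adjacent_intervals (n := n) (a := a)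
    (f := fun x : ℝ => g (⌈(n : ℝ) * x⌉₊ - 1)) (μ := MeasureTheory.volume) fun k _ =>
      (intervalIntegrable_congr (hconst k)).mpr intervalIntegrable_const
  simp only [hint, ← Finset.sum_div] at hadj
  rw [hadj, ← intervalIntegral.integral_of_le zero_le_one]
  simp [a, hn'.ne']

theorem stmt3 {n : ℕ} (G H : SimpleGraph (Fin n))
    [DecidableRel G.Adj] [DecidableRel H.Adj] :
    ∑ k : Fin n, |(eigList G).getD (k : ℕ) 0 - (eigList H).getD (k : ℕ) 0| ≤
      4 * (graphDist G H : ℝ) ∧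
    ∫ x in Set.Ioc (0:ℝ) 1,
        |specFun ⟨Fin n, inferInstance, G⟩ x - specFun ⟨Fin n, inferInstance, H⟩ x| ≤
      4 * (graphDist G H : ℝ) / n := by
  have hsum : ∑ k ∈ Finset.range n, |(eigList G).getD k 0 - (eigList H).getD k 0| ≤
      4 * (graphDist G H : ℝ) := by
    have h := sum_abs_eigList_sub_le G H
    rw [Fintype.card_fin] at h
    have : (0 : ℝ) ≤ graphDist G H := Nat.cast_nonneg _
    linarith
  refine ⟨by rwa [← Finset.sum_range
    fun k => |(eigList G).getD k 0 - (eigList H).getD k 0|], ?_⟩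
  simp only [specFun_fin]
  rcases eq_or_ne n 0 with rfl | hn
  · have hnil (K : SimpleGraph (Fin 0)) [DecidableRel K.Adj] : eigList K = [] :=
      List.length_eq_zero_iff.mp (length_eigList K)
    simp [hnil]
  · rw [integral_step_function hn fun k => |(eigList G).getD k 0 - (eigList H).getD k 0|]
    gcongr
end

section
/- For any two real symmetric n x n matrices A and B with eigenvalues alpha_1 <= alpha_2 <= ... <= alpha_n and beta_1 <= beta_2 <= ... <= beta_n (each listed with multiplicity in increasing order), one has sum_{i=1}^n |alpha_i - beta_i| <= sum_{i,j=1}^n |A_{ij} - B_{ij}|. -/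
open SimpleGraph


/-- The Rayleigh quotient numerator of a symmetric operator in an eigenbasis. -/
theorem inner_map_self_eq_sum_eigenvalues {ι E : Type*} [Fintype ι] [NormedAddCommGroup E]
    [InnerProductSpace ℝ E] {S : E →ₗ[ℝ] E} (hS : S.IsSymmetric) (u : OrthonormalBasis ι ℝ E)
    {a : ι → ℝ} (hu : ∀ j, S (u j) = a j • u j) (x : E) :
    inner ℝ x (S x) = ∑ j, a j * inner ℝ (u j) x ^ 2 := by
  rw [← u.sum_inner_mul_inner x (S x)]
  refine Finset.sum_congr rfl fun j _ => ?_
  rw [← hS (u j) x, hu, real_inner_smul_left, real_inner_comm]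
  ring

/-- Weyl monotonicity: increasingly ordered eigenvalues are monotone in the quadratic form. -/
theorem eigenvalue_le_of_inner_map_self_le {n : ℕ} {E : Type*} [NormedAddCommGroup E]
    [InnerProductSpace ℝ E] {S T : E →ₗ[ℝ] E} (hS : S.IsSymmetric) (hT : T.IsSymmetric)
    (u v : OrthonormalBasis (Fin n) ℝ E) {a c : Fin n → ℝ}
    (ha : Monotone a) (hc : Monotone c)
    (hu : ∀ j, S (u j) = a j • u j) (hv : ∀ j, T (v j) = c j • v j)
    (h : ∀ x, inner ℝ x (S x) ≤ inner ℝ x (T x)) (i : Fin n) : a i ≤ c i := by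
  have : FiniteDimensional ℝ E := u.toBasis.finiteDimensional_of_finite
  let L : E →ₗ[ℝ] ({j : Fin n // j ≠ i} → ℝ) :=
    LinearMap.pi fun j => if j.1 < i then innerₗ E (u j) else innerₗ E (v j)
  have hdim : Module.finrank ℝ ({j : Fin n // j ≠ i} → ℝ) < Module.finrank ℝ E := by
    rw [Module.finrank_fintype_fun_eq_card, Module.finrank_eq_card_basis u.toBasis]
    exact Fintype.card_subtype_lt (x := i) (by simp)
  obtain ⟨x, hx, hx0⟩ :=
    (Submodule.ne_bot_iff _).1 (LinearMap.ker_ne_bot_of_finrank_lt hdim (f := L))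
  have hL (j : Fin n) (hj : j ≠ i) := congrFun (LinearMap.mem_ker.1 hx) ⟨j, hj⟩
  have hux (j : Fin n) (hj : j < i) : inner ℝ (u j) x = 0 := by
    simpa [L, hj] using hL j hj.ne
  have hvx (j : Fin n) (hj : i < j) : inner ℝ (v j) x = 0 := by
    simpa [L, hj.not_gt] using hL j hj.ne'
  have hlow : a i * ‖x‖ ^ 2 ≤ inner ℝ x (S x) := by
    rw [inner_map_self_eq_sum_eigenvalues hS u hu, ← u.sum_sq_inner_right x, Finset.mul_sum]
    refine Finset.sum_le_sum fun j _ => ?_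
    rcases lt_or_ge j i with hj | hj
    · simp [hux j hj]
    · exact mul_le_mul_of_nonneg_right (ha hj) (sq_nonneg _)
  have hup : inner ℝ x (T x) ≤ c i * ‖x‖ ^ 2 := by
    rw [inner_map_self_eq_sum_eigenvalues hT v hv, ← v.sum_sq_inner_right x, Finset.mul_sum]
    refine Finset.sum_le_sum fun j _ => ?_
    rcases lt_or_ge i j with hj | hj
    · simp [hvx j hj]
    · exact mul_le_mul_of_nonneg_right (hc hj) (sq_nonneg _)
  exact le_of_mul_le_mul_right ((hlow.trans (h x)).trans hup) (by positivity)

theorem matEigList_eq_ofFn {n : ℕ} {A : Matrix (Fin n) (Fin n) ℝ} (hA : A.IsHermitian) :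
    matEigList hA = List.ofFn (hA.eigenvalues ∘ Tuple.sort hA.eigenvalues) := by
  refine List.Perm.eq_of_pairwise' (r := (· ≤ ·)) (Multiset.pairwise_sort _ _)
    (Tuple.monotone_sort hA.eigenvalues).sortedLE_ofFn.pairwise ?_
  rw [← Multiset.coe_eq_coe, matEigList, Multiset.sort_eq, List.ofFn_eq_map, ← Multiset.map_coe]
  change _ = Multiset.map _ Finset.univ.val
  rw [← Multiset.map_map]
  congr 1
  exact (Multiset.map_univ_val_equiv _).symm

theorem matEigList_getD {n : ℕ} {A : Matrix (Fin n) (Fin n) ℝ} (hA : A.IsHermitian) (i : Fin n) :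
    (matEigList hA).getD i 0 = hA.eigenvalues (Tuple.sort hA.eigenvalues i) := by
  simp [matEigList_eq_ofFn]

theorem sum_matEigList_getD {n : ℕ} {A : Matrix (Fin n) (Fin n) ℝ} (hA : A.IsHermitian) :
    ∑ i : Fin n, (matEigList hA).getD i 0 = A.trace := by
  simp_rw [matEigList_getD, hA.trace_eq_sum_eigenvalues]
  exact Equiv.sum_comp (Tuple.sort hA.eigenvalues) hA.eigenvalues

theorem matEigList_getD_le_of_posSemidef_sub {n : ℕ} {A C : Matrix (Fin n) (Fin n) ℝ}
    (hA : A.IsHermitian) (hC : C.IsHermitian) (h : (C - A).PosSemidef) (i : Fin n) :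
    (matEigList hA).getD i 0 ≤ (matEigList hC).getD i 0 := by
  simp_rw [matEigList_getD]
  have key {M : Matrix (Fin n) (Fin n) ℝ} (hM : M.IsHermitian) (j : Fin n) :
      M.toEuclideanLin (hM.eigenvectorBasis.reindex (Tuple.sort hM.eigenvalues).symm j) =
        (hM.eigenvalues ∘ Tuple.sort hM.eigenvalues) j •
          hM.eigenvectorBasis.reindex (Tuple.sort hM.eigenvalues).symm j := by
    ext k
    simp [Matrix.toLpLin_apply, hM.mulVec_eigenvectorBasis]
  refine eigenvalue_le_of_inner_map_self_le (Matrix.isSymmetric_toEuclideanLin_iff.2 hA)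
    (Matrix.isSymmetric_toEuclideanLin_iff.2 hC) _ _ (Tuple.monotone_sort _)
    (Tuple.monotone_sort _) (key hA) (key hC) (fun x => ?_) i
  have := h.dotProduct_mulVec_nonneg x.ofLp
  rw [Matrix.sub_mulVec, dotProduct_sub, sub_nonneg] at this
  simpa [EuclideanSpace.inner_eq_star_dotProduct, Matrix.toLpLin_apply, dotProduct_comm] using this

open scoped Matrix in
/-- A symmetric matrix plus the diagonal matrix of its absolute row sums is positive semidefinite. -/
theorem posSemidef_diagonal_sum_abs_add {n : ℕ} {D : Matrix (Fin n) (Fin n) ℝ} (hD : D.IsSymm) :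
    (Matrix.diagonal (fun i => ∑ j, |D i j|) + D).PosSemidef := by
  refine .of_dotProduct_mulVec_nonneg
    ((Matrix.isHermitian_diagonal _).add hD.isHermitianReal) fun x => ?_
  have hswap : ∑ i, ∑ j, |D i j| * x i ^ 2 = ∑ i, ∑ j, |D i j| * x j ^ 2 := by
    rw [Finset.sum_comm]
    exact Finset.sum_congr rfl fun i _ => Finset.sum_congr rfl fun j _ => by rw [hD.apply]
  have hform : star x ⬝ᵥ (Matrix.diagonal (fun i => ∑ j, |D i j|) + D) *ᵥ x =
      ∑ i, ∑ j, (|D i j| * x i ^ 2 + D i j * x i * x j) := by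
    rw [Matrix.add_mulVec, dotProduct_add]
    simp_rw [Finset.sum_add_distrib]
    congr 1
    · simp only [dotProduct, Matrix.mulVec_diagonal, Pi.star_apply, star_trivial,
        Finset.mul_sum, Finset.sum_mul]
      exact Finset.sum_congr rfl fun i _ => Finset.sum_congr rfl fun j _ => by ring
    · simp only [dotProduct, Matrix.mulVec, Pi.star_apply, star_trivial, Finset.mul_sum]
      exact Finset.sum_congr rfl fun i _ => Finset.sum_congr rfl fun j _ => by ring
  have hsum : 2 * ∑ i, ∑ j, (|D i j| * x i ^ 2 + D i j * x i * x j) =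
      ∑ i, ∑ j, (|D i j| * (x i ^ 2 + x j ^ 2) + 2 * (D i j * x i * x j)) := by
    simp_rw [mul_add, Finset.sum_add_distrib, ← Finset.mul_sum]
    rw [← hswap]
    ring
  have hnonneg : 0 ≤ ∑ i, ∑ j, (|D i j| * (x i ^ 2 + x j ^ 2) + 2 * (D i j * x i * x j)) := by
    refine Finset.sum_nonneg fun i _ => Finset.sum_nonneg fun j _ => ?_
    rcases abs_cases (D i j) with ⟨hd, hs⟩ | ⟨hd, hs⟩ <;> rw [hd]
    · nlinarith [mul_nonneg hs (sq_nonneg (x i + x j))]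
    · nlinarith [mul_nonneg (neg_nonneg.2 hs.le) (sq_nonneg (x i - x j))]
  rw [hform]
  linarith

theorem stmt5 {n : ℕ} (A B : Matrix (Fin n) (Fin n) ℝ)
    (hA : A.IsSymm) (hB : B.IsSymm) :
    ∑ i : Fin n, |(matEigList hA.isHermitianReal).getD (i : ℕ) 0 -
        (matEigList hB.isHermitianReal).getD (i : ℕ) 0| ≤
      ∑ i : Fin n, ∑ j : Fin n, |A i j - B i j| := by
  set R : Matrix (Fin n) (Fin n) ℝ := Matrix.diagonal fun i => ∑ j, |A i j - B i j| with hR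
  have hCsymm : ((1 / 2 : ℝ) • (A + B + R)).IsSymm :=
    ((hA.add hB).add (Matrix.isSymm_diagonal _)).smul _
  have hC := hCsymm.isHermitianReal
  have hAC : ((1 / 2 : ℝ) • (A + B + R) - A).PosSemidef := by
    convert (posSemidef_diagonal_sum_abs_add (hB.sub hA)).smul (show (0 : ℝ) ≤ 1 / 2 by norm_num)
      using 1
    simp_rw [hR, Matrix.sub_apply, abs_sub_comm (B _ _)]
    module
  have hBC : ((1 / 2 : ℝ) • (A + B + R) - B).PosSemidef := by
    convert (posSemidef_diagonal_sum_abs_add (hA.sub hB)).smul (show (0 : ℝ) ≤ 1 / 2 by norm_num)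
      using 1
    simp_rw [hR, Matrix.sub_apply]
    module
  calc
    _ ≤ ∑ i : Fin n, (2 * (matEigList hC).getD i 0 - (matEigList hA.isHermitianReal).getD i 0 -
          (matEigList hB.isHermitianReal).getD i 0) := by
      refine Finset.sum_le_sum fun i _ => ?_
      have h₁ := matEigList_getD_le_of_posSemidef_sub hA.isHermitianReal hC hAC i
      have h₂ := matEigList_getD_le_of_posSemidef_sub hB.isHermitianReal hC hBC i
      rw [abs_le]
      constructor <;> linarith
    _ = R.trace := by
      simp_rw [Finset.sum_sub_distrib, ← Finset.mul_sum, sum_matEigList_getD, Matrix.trace_smul,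
        Matrix.trace_add, smul_eq_mul]
      ring
    _ = _ := Matrix.trace_diagonal _
end

section
/- For every nonempty finite simple graph G whose largest cliques have q+1 vertices, the chromatic number of the Barycentric refinement psi(G) equals q+1; an explicit minimal coloring is given by assigning to each clique its cardinality. -/
open SimpleGraph


theorem ssubset_or_ssubset_of_bary_adj {V : Type} {G : SimpleGraph V} {a b : cliqueVerts G}
    (h : (bary G).Adj a b) :
    (a : Finset V) ⊂ (b : Finset V) ∨ (b : Finset V) ⊂ (a : Finset V) :=
  ((SimpleGraph.fromRel_adj _ a b).1 h).2

theorem card_ne_card_of_bary_adj {V : Type} {G : SimpleGraph V} {a b : cliqueVerts G}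
    (h : (bary G).Adj a b) : (a : Finset V).card ≠ (b : Finset V).card := by
  rcases ssubset_or_ssubset_of_bary_adj h with h | h
  · exact (Finset.card_lt_card h).ne
  · exact (Finset.card_lt_card h).ne'

theorem bary_adj_of_ssubset {V : Type} {G : SimpleGraph V} {a b : cliqueVerts G}
    (h : (a : Finset V) ⊂ (b : Finset V)) : (bary G).Adj a b :=
  (SimpleGraph.fromRel_adj _ a b).2 ⟨fun hab => h.ne (congrArg Subtype.val hab), Or.inl h⟩

/-- Coloring each clique by its cardinality (shifted to start at zero) is proper. -/
theorem bary_colorable {V : Type} {G : SimpleGraph V} {n : ℕ}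
    (h : ∀ s : Finset V, G.IsClique (s : Set V) → s.card ≤ n) : (bary G).Colorable n := by
  have hpos (a : cliqueVerts G) : 0 < (a : Finset V).card := a.2.1.card_pos
  refine ⟨SimpleGraph.Coloring.mk
    (fun a => (⟨(a : Finset V).card - 1, ?_⟩ : Fin n)) fun {a b} hab heq => ?_⟩
  · have := h a a.2.2
    have := hpos a
    omega
  · have := congrArg Fin.val heq
    have := card_ne_card_of_bary_adj hab
    have := hpos a
    have := hpos b
    simp only at *
    omega

/-- A clique with `n` vertices gives a full flag of subcliques, which is a clique with `n`
vertices in the Barycentric refinement. -/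
theorem nonempty_hom_bary_of_isNClique {V : Type} {G : SimpleGraph V} {n : ℕ} {s : Finset V}
    (hs : G.IsNClique n s) : Nonempty ((⊤ : SimpleGraph (Fin n)) →g bary G) := by
  let e : Fin n ↪ V :=
    (s.equivFinOfCardEq hs.card_eq).symm.toEmbedding.trans (Function.Embedding.subtype _)
  have he (i : Fin n) : e i ∈ s := ((s.equivFinOfCardEq hs.card_eq).symm i).2
  let flag (i : Fin n) : cliqueVerts G := ⟨(Finset.Iic i).map e, by simp, by
    refine hs.isClique.subset fun x hx => ?_
    obtain ⟨j, -, rfl⟩ := Finset.mem_map.1 hx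
    exact he j⟩
  have hflag {i j : Fin n} (hij : i < j) : (bary G).Adj (flag i) (flag j) :=
    bary_adj_of_ssubset (Finset.map_ssubset_map.2 (Finset.Iic_ssubset_Iic.2 hij))
  refine ⟨⟨flag, fun {i j} hij => ?_⟩⟩
  rcases lt_or_gt_of_ne hij.ne with h | h
  · exact hflag h
  · exact (hflag h).symm

theorem stmt9 {V : Type} [Fintype V] (q : ℕ) (G : SimpleGraph V)
    (hne : Nonempty V) (hmax : MaxDim G q) :
    (bary G).chromaticNumber = (q : ℕ∞) + 1 ∧
    ∀ a b : cliqueVerts G, (bary G).Adj a b →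
      (a : Finset V).card ≠ (b : Finset V).card := by
  obtain ⟨⟨s, hs⟩, hcard⟩ := hmax
  obtain ⟨f⟩ := nonempty_hom_bary_of_isNClique hs
  refine ⟨le_antisymm ?_ ?_, fun _ _ => card_ne_card_of_bary_adj⟩
  · exact_mod_cast (bary_colorable hcard).chromaticNumber_le
  · simpa using SimpleGraph.chromaticNumber_mono_of_hom f
end

section
/- Let G be a 2-manifold with f-vector (f0, f1, f2). Then the soft Barycentric refinement phi(G) has f-vector (f0 + f2, f1 + 3 f2, 3 f2); in particular the Euler characteristic f0 - f1 + f2 is preserved: chi(phi(G)) = chi(G). -/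
open SimpleGraph


theorem not_sphereFuel_of_lt_neg_one (n : ℕ) {d : ℤ} (hd : d < -1) {V : Type}
    (G : SimpleGraph V) : ¬ SphereFuel n d G := by
  induction n generalizing d V with
  | zero => rintro ⟨h, -⟩; omega
  | succ n ih =>
    rintro (⟨h, -⟩ | ⟨h, v, -⟩)
    · omega
    · exact ih (by omega) _ (h v)

theorem SphereFuel.isEmpty {n : ℕ} {V : Type} {G : SimpleGraph V}
    (h : SphereFuel n (-1) G) : IsEmpty V := by
  cases n with
  | zero => exact h.2
  | succ n =>
    obtain ⟨-, h⟩ | ⟨h, v, -⟩ := h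
    · exact h
    · exact (not_sphereFuel_of_lt_neg_one n (by omega) _ (h v)).elim

theorem ContractibleFuel.nonempty {n : ℕ} {V : Type} {G : SimpleGraph V}
    (h : ContractibleFuel n G) : Nonempty V := by
  cases n with
  | zero => exact h.elim
  | succ n =>
    obtain ⟨h, -⟩ | ⟨v, -⟩ := h
    · exact h
    · exact ⟨v⟩

theorem ContractibleFuel.subsingleton {n : ℕ} {V : Type} {G : SimpleGraph V}
    (h : ContractibleFuel n G) (hG : ∀ a b, ¬ G.Adj a b) : Subsingleton V := by
  cases n with
  | zero => exact h.elim
  | succ n =>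
    obtain ⟨-, h⟩ | ⟨v, h, -⟩ := h
    · exact h
    · obtain ⟨w, hw⟩ := h.nonempty
      exact (hG _ _ hw).elim

theorem SphereFuel.exists_pair {n : ℕ} {V : Type} {G : SimpleGraph V}
    (h : SphereFuel n 0 G) :
    (∀ a b, ¬ G.Adj a b) ∧ ∃ a b : V, a ≠ b ∧ ∀ w, w = a ∨ w = b := by
  cases n with
  | zero => exact absurd h.1 (by decide)
  | succ n =>
    obtain ⟨h, -⟩ | ⟨h, v, hv⟩ := h
    · exact absurd h (by decide)
    · have hG : ∀ a b, ¬ G.Adj a b := fun a b hab =>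
        (SphereFuel.isEmpty (n := n) (h a)).false ⟨b, hab⟩
      have hs := hv.subsingleton fun a b => hG a b
      obtain ⟨w, hw⟩ := hv.nonempty
      refine ⟨hG, v, w, Ne.symm hw, fun x => or_iff_not_imp_left.2 fun hx => ?_⟩
      exact congrArg Subtype.val (hs.elim ⟨x, hx⟩ ⟨w, hw⟩)

theorem IsGraphManifold.exists_common_neighbors {V : Type} [Finite V] {G : SimpleGraph V}
    (hG : IsGraphManifold 2 G) {u v : V} (huv : G.Adj u v) :
    ∃ a b, a ≠ b ∧ ¬ G.Adj a b ∧ ∀ w, (G.Adj u w ∧ G.Adj v w) ↔ w = a ∨ w = b := by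
  obtain ⟨h, -⟩ | ⟨h, -⟩ := hG.2 u
  · exact absurd h (by decide)
  · obtain ⟨hK, ⟨⟨a, ha⟩, ha'⟩, ⟨⟨b, hb⟩, hb'⟩, hab, hw⟩ :=
      SphereFuel.exists_pair (n := Nat.card (G.neighborSet u)) (h ⟨v, huv⟩)
    refine ⟨a, b, fun h => hab (by simp [h]), fun h => hK ⟨⟨a, ha⟩, ha'⟩ ⟨⟨b, hb⟩, hb'⟩ h,
      fun w => ⟨fun ⟨h₁, h₂⟩ => ?_, ?_⟩⟩
    · exact (hw ⟨⟨w, h₁⟩, h₂⟩).imp (fun h => congrArg (fun x => x.1.1) h)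
        fun h => congrArg (fun x => x.1.1) h
    · rintro (rfl | rfl)
      exacts [⟨ha, ha'⟩, ⟨hb, hb'⟩]

/-- Every edge of `G` has exactly two common neighbors, and these are not adjacent. -/
def IsSurface {V : Type} (G : SimpleGraph V) : Prop :=
  ∀ u v, G.Adj u v →
    ∃ a b, a ≠ b ∧ ¬ G.Adj a b ∧ ∀ w, (G.Adj u w ∧ G.Adj v w) ↔ w = a ∨ w = b

section Surface

variable {V : Type} {G : SimpleGraph V}

theorem IsSurface.card_le_three (hG : IsSurface G) {s : Finset V}
    (hs : G.IsClique (s : Set V)) : s.card ≤ 3 := by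
  classical
  by_contra! h
  obtain ⟨u, hu, v, hv, huv⟩ := Finset.one_lt_card.1 (show 1 < s.card by omega)
  obtain ⟨a, b, -, hab, hw⟩ := hG u v (hs hu hv huv)
  have hle : (s \ {u, v}).card ≤ 1 := by
    refine Finset.card_le_one.2 fun x hx y hy => ?_
    simp only [Finset.mem_sdiff, Finset.mem_insert, Finset.mem_singleton, not_or] at hx hy
    by_contra hxy
    have hadj := hs hx.1 hy.1 hxy
    have hxw := (hw x).1 ⟨hs hu hx.1 (Ne.symm hx.2.1), hs hv hx.1 (Ne.symm hx.2.2)⟩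
    have hyw := (hw y).1 ⟨hs hu hy.1 (Ne.symm hy.2.1), hs hv hy.1 (Ne.symm hy.2.2)⟩
    have hba := fun h : G.Adj b a => hab h.symm
    rcases hxw with rfl | rfl <;> rcases hyw with rfl | rfl <;> simp_all
  have h₁ := Finset.le_card_sdiff {u, v} s
  have h₂ := Finset.card_le_two (a := u) (b := v)
  omega

theorem IsSurface.exists_two_triangles (hG : IsSurface G) {e : Finset V}
    (he : G.IsNClique 2 e) :
    ∃ t₁ t₂, t₁ ≠ t₂ ∧ ∀ t, (G.IsNClique 3 t ∧ e ⊆ t) ↔ t = t₁ ∨ t = t₂ := by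
  classical
  obtain ⟨u, v, huv, rfl⟩ := Finset.card_eq_two.1 he.card_eq
  have hadj : G.Adj u v := he.isClique (by simp) (by simp) huv
  obtain ⟨a, b, hab, -, hw⟩ := hG u v hadj
  obtain ⟨hua, hva⟩ := (hw a).2 (.inl rfl)
  obtain ⟨hub, hvb⟩ := (hw b).2 (.inr rfl)
  have key : ∀ w, G.Adj u w ∧ G.Adj v w →
      G.IsNClique 3 {u, v, w} ∧ ({u, v} : Finset V) ⊆ {u, v, w} := fun w h =>
    ⟨is3Clique_triple_iff.2 ⟨hadj, h.1, h.2⟩, by intro x; simp; tauto⟩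
  refine ⟨{u, v, a}, {u, v, b}, fun h => ?_, fun t => ⟨fun ⟨ht, hsub⟩ => ?_, ?_⟩⟩
  · have : a ∈ ({u, v, b} : Finset V) := h ▸ by simp
    simp [hab, hua.ne', hva.ne'] at this
  · have hcard : (t \ {u, v}).card = 1 := by
      rw [Finset.card_sdiff_of_subset hsub, ht.card_eq, he.card_eq]
    obtain ⟨w, hwt⟩ := Finset.card_eq_one.1 hcard
    have htw : t = {u, v, w} := by
      rw [← Finset.union_sdiff_of_subset hsub, hwt]
      ext x; simp
    subst htw
    obtain ⟨-, h₁, h₂⟩ := is3Clique_triple_iff.1 ht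
    rcases (hw w).1 ⟨h₁, h₂⟩ with rfl | rfl <;> simp
  · rintro (rfl | rfl)
    exacts [key _ ⟨hua, hva⟩, key _ ⟨hub, hvb⟩]

theorem IsSurface.ncard_triangles (hG : IsSurface G) {e : Finset V} (he : G.IsNClique 2 e) :
    {t : Finset V | G.IsNClique 3 t ∧ e ⊆ t}.ncard = 2 := by
  obtain ⟨t₁, t₂, hne, h⟩ := hG.exists_two_triangles he
  rw [show {t : Finset V | G.IsNClique 3 t ∧ e ⊆ t} = {t₁, t₂} from Set.ext h,
    Set.ncard_pair hne]

theorem isNClique_inter [DecidableEq V] {m n : ℕ} {s t : Finset V} (hs : G.IsNClique n s)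
    (h : (s ∩ t).card = m) : G.IsNClique m (s ∩ t) :=
  ⟨hs.isClique.subset (by simp), h⟩

theorem inter_eq_of_card_two [DecidableEq V] {e s t : Finset V} (he : e.card = 2)
    (hs : s.card = 3) (ht : t.card = 3) (hst : s ≠ t) (hes : e ⊆ s) (het : e ⊆ t) :
    s ∩ t = e := by
  refine (Finset.eq_of_subset_of_card_le (Finset.subset_inter hes het) ?_).symm
  rw [he]
  by_contra! h
  have h₁ := Finset.eq_of_subset_of_card_le (Finset.inter_subset_left (s₁ := s) (s₂ := t))
    (by omega)
  have h₂ := Finset.eq_of_subset_of_card_le (Finset.inter_subset_right (s₁ := s) (s₂ := t))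
    (by omega)
  exact hst (h₁.symm.trans h₂)

theorem IsSurface.not_three_adjacent_triangles [DecidableEq V] (hG : IsSurface G)
    {r s t : Finset V} (hr : G.IsNClique 3 r) (hs : G.IsNClique 3 s) (ht : G.IsNClique 3 t)
    (hrs : r ≠ s) (hrt : r ≠ t) (hst : s ≠ t) (crs : (r ∩ s).card = 2)
    (crt : (r ∩ t).card = 2) (cst : (s ∩ t).card = 2) : False := by
  by_cases her : s ∩ t ⊆ r
  · obtain ⟨t₁, t₂, -, h⟩ := hG.exists_two_triangles (isNClique_inter hs cst)
    have h₁ := (h r).1 ⟨hr, her⟩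
    have h₂ := (h s).1 ⟨hs, Finset.inter_subset_left⟩
    have h₃ := (h t).1 ⟨ht, Finset.inter_subset_right⟩
    grind
  · have sdiff_subset : ∀ {p q : Finset V}, p.card = 3 → (p ∩ q).card = 2 →
        (r ∩ p).card = 2 → ¬ p ∩ q ⊆ r → p \ q ⊆ r := by
      intro p q hp hpq hrp hsub
      have hone : (p \ q).card = 1 := by
        have := Finset.card_sdiff_add_card_inter p q
        omega
      obtain ⟨x, hx⟩ := Finset.card_eq_one.1 hone
      rw [hx, Finset.singleton_subset_iff]
      by_contra hxr
      have hsub' : r ∩ p ⊆ p ∩ q := fun y hy => by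
        rw [Finset.mem_inter] at hy ⊢
        refine ⟨hy.2, ?_⟩
        by_contra hyq
        have : y ∈ p \ q := Finset.mem_sdiff.2 ⟨hy.2, hyq⟩
        rw [hx, Finset.mem_singleton] at this
        exact hxr (this ▸ hy.1)
      have heq := Finset.eq_of_subset_of_card_le hsub' (by omega)
      exact hsub (heq ▸ Finset.inter_subset_left)
    have h₁ := sdiff_subset hs.card_eq cst crs her
    have h₂ := sdiff_subset ht.card_eq (Finset.inter_comm s t ▸ cst) crt
      (Finset.inter_comm s t ▸ her)
    have hcl : G.IsClique ((s ∪ t : Finset V) : Set V) := by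
      intro x hx y hy hxy
      simp only [Finset.coe_union, Set.mem_union, Finset.mem_coe] at hx hy
      have h₁' := fun z hz hz' => h₁ (Finset.mem_sdiff.2 ⟨hz, hz'⟩ : z ∈ s \ t)
      have h₂' := fun z hz hz' => h₂ (Finset.mem_sdiff.2 ⟨hz, hz'⟩ : z ∈ t \ s)
      by_cases hxs : x ∈ s <;> by_cases hys : y ∈ s
      · exact hs.isClique hxs hys hxy
      · by_cases hxt : x ∈ t
        · exact ht.isClique hxt (hy.resolve_left hys) hxy
        · exact hr.isClique (h₁' x hxs hxt) (h₂' y (hy.resolve_left hys) hys) hxy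
      · by_cases hyt : y ∈ t
        · exact ht.isClique (hx.resolve_left hxs) hyt hxy
        · exact hr.isClique (h₂' x (hx.resolve_left hxs) hxs) (h₁' y hys hyt) hxy
      · exact ht.isClique (hx.resolve_left hxs) (hy.resolve_left hys) hxy
    have h₃ := hG.card_le_three hcl
    have h₄ := Finset.card_union_add_card_inter s t
    rw [hs.card_eq, ht.card_eq] at h₄
    omega

/-- The soft Barycentric refinement of a surface, modelled on vertices and triangles. -/
def softModel [DecidableEq V] (G : SimpleGraph V) :
    SimpleGraph (V ⊕ {t : Finset V // G.IsNClique 3 t}) where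
  Adj
    | .inl _, .inl _ => False
    | .inl v, .inr t => v ∈ t.1
    | .inr t, .inl v => v ∈ t.1
    | .inr s, .inr t => s ≠ t ∧ (s.1 ∩ t.1).card = 2
  symm := ⟨by
    rintro (u | s) (v | t) h
    · exact h
    · exact h
    · exact h
    · exact ⟨h.1.symm, Finset.inter_comm s.1 t.1 ▸ h.2⟩⟩
  loopless := ⟨by
    rintro (u | s) h
    · exact h
    · exact h.1 rfl⟩

theorem IsSurface.mem_softVerts_iff (hG : IsSurface G) {s : Finset V} :
    s ∈ softVerts G 2 ↔ (∃ v, {v} = s) ∨ G.IsNClique 3 s := by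
  refine ⟨fun ⟨hne, hcl, h⟩ => ?_, ?_⟩
  · have h2 : s.card ≠ 2 := by
      rcases h with h | ⟨h, h'⟩
      · exact h
      · have := hG.ncard_triangles h
        exact absurd (this.symm.trans h') (by decide)
    have h3 := hG.card_le_three hcl
    have h0 := hne.card_pos
    obtain h1 | h1 : s.card = 1 ∨ s.card = 3 := by omega
    · obtain ⟨v, rfl⟩ := Finset.card_eq_one.1 h1
      exact .inl ⟨v, rfl⟩
    · exact .inr ⟨hcl, h1⟩
  · rintro (⟨v, rfl⟩ | h)
    · exact ⟨by simp, by simp, .inl (by simp)⟩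
    · exact ⟨Finset.card_pos.1 (by rw [h.card_eq]; omega), h.isClique,
        .inl (by rw [h.card_eq]; omega)⟩

theorem softBary_two_adj [inst : DecidableEq V] {a b : softVerts G 2} :
    (softBary G 2).Adj a b ↔ a.1 ≠ b.1 ∧ ((a.1 ⊂ b.1 ∨ b.1 ⊂ a.1) ∨
      G.IsNClique 3 a.1 ∧ G.IsNClique 3 b.1 ∧ IsInteriorFace G 2 (a.1 ∩ b.1)) := by
  obtain rfl : inst = Classical.decEq V := Subsingleton.elim _ _
  have h := @Finset.inter_comm V (Classical.decEq V) b.1 a.1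
  rw [softBary, fromRel_adj, h, Ne, Ne, Subtype.ext_iff]
  tauto

/-- The vertex of the soft Barycentric refinement given by a vertex of the model. -/
def softModelToSoftVerts (hG : IsSurface G) :
    V ⊕ {t : Finset V // G.IsNClique 3 t} → softVerts G 2
  | .inl v => ⟨{v}, hG.mem_softVerts_iff.2 (.inl ⟨v, rfl⟩)⟩
  | .inr t => ⟨t.1, hG.mem_softVerts_iff.2 (.inr t.2)⟩

theorem not_isNClique_three_singleton (v : V) : ¬ G.IsNClique 3 {v} := fun h => by
  simpa using h.card_eq

theorem softModelToSoftVerts_bijective (hG : IsSurface G) :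
    Function.Bijective (softModelToSoftVerts hG) := by
  constructor
  · rintro (u | s) (v | t) h <;> have h' := congrArg Subtype.val h <;>
      simp only [softModelToSoftVerts] at h'
    · simpa using h'
    · exact (not_isNClique_three_singleton u (h' ▸ t.2)).elim
    · exact (not_isNClique_three_singleton v (h' ▸ s.2)).elim
    · rw [Subtype.ext h']
  · rintro ⟨s, hs⟩
    obtain ⟨v, rfl⟩ | h := hG.mem_softVerts_iff.1 hs
    exacts [⟨.inl v, rfl⟩, ⟨.inr ⟨s, h⟩, rfl⟩]

theorem softBary_adj_softModelToSoftVerts [DecidableEq V] (hG : IsSurface G)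
    (x y : V ⊕ {t : Finset V // G.IsNClique 3 t}) :
    (softBary G 2).Adj (softModelToSoftVerts hG x) (softModelToSoftVerts hG y) ↔
      (softModel G).Adj x y := by
  have hnot := not_isNClique_three_singleton (G := G)
  have hcard : ∀ {s t : Finset V}, t.card ≤ s.card → ¬ s ⊂ t := fun h h' =>
    (Finset.card_lt_card h').not_ge h
  have hmem : ∀ {v : V} {t : Finset V}, G.IsNClique 3 t →
      ({v} ≠ t ∧ ({v} ⊂ t ∨ t ⊂ {v}) ↔ v ∈ t) := fun {v t} ht => by
    have h1 : ¬ t ⊂ {v} := hcard (by simp [ht.card_eq])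
    have h2 : ({v} : Finset V) ≠ t := fun h => hnot v (h ▸ ht)
    simp [h1, h2, Finset.ssubset_iff_subset_ne]
  rw [softBary_two_adj]
  obtain u | ⟨s, hs⟩ := x <;> obtain v | ⟨t, ht⟩ := y <;>
    simp only [softModelToSoftVerts, softModel, hnot, false_and, and_false, or_false]
  · simp [Finset.ssubset_singleton_iff]
  · exact hmem ht
  · rw [ne_comm, or_comm, hmem hs]
  · have hint : IsInteriorFace G 2 (s ∩ t) ↔ (s ∩ t).card = 2 :=
      ⟨fun h => h.1.card_eq, fun h =>
        ⟨isNClique_inter hs h, hG.ncard_triangles (isNClique_inter hs h)⟩⟩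
    have h1 : ¬ s ⊂ t := hcard (by rw [hs.card_eq, ht.card_eq])
    have h2 : ¬ t ⊂ s := hcard (by rw [hs.card_eq, ht.card_eq])
    simp [hint, h1, h2, hs, ht]

/-- The identification of the model with the soft Barycentric refinement. -/
noncomputable def softModelIso [DecidableEq V] (hG : IsSurface G) :
    softModel G ≃g softBary G 2 where
  toEquiv := Equiv.ofBijective _ (softModelToSoftVerts_bijective hG)
  map_rel_iff' := softBary_adj_softModelToSoftVerts hG _ _

end Surface

theorem fcount_congr {V W : Type} {G : SimpleGraph V} {H : SimpleGraph W} (e : G ≃g H)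
    (k : ℕ) : fcount G k = fcount H k := by
  refine Nat.card_congr (e.toEquiv.finsetCongr.subtypeEquiv fun s => ?_)
  have h : ∀ a b, H.Adj (e a) (e b) ↔ G.Adj a b := fun _ _ => e.map_adj_iff
  simp [isNClique_iff, IsClique, Set.Pairwise, h]

theorem fcount_one {W : Type} [Finite W] (H : SimpleGraph W) : fcount H 1 = Nat.card W := by
  refine (Nat.card_congr (Equiv.ofBijective (fun w => ⟨{w}, by simp⟩) ⟨fun v w h => ?_, ?_⟩)).symm
  · simpa using h
  · rintro ⟨s, hs⟩
    obtain ⟨w, rfl⟩ := Finset.card_eq_one.1 hs.card_eq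
    exact ⟨w, rfl⟩

section Counting

variable {V : Type} [DecidableEq V] {G : SimpleGraph V}

theorem softModel_isNClique_disjSum {L : Finset V}
    {R : Finset {t : Finset V // G.IsNClique 3 t}} {k : ℕ} :
    (softModel G).IsNClique k (L.disjSum R) ↔ L.card ≤ 1 ∧
      (∀ s ∈ R, ∀ t ∈ R, s ≠ t → (s.1 ∩ t.1).card = 2) ∧
      (∀ v ∈ L, ∀ t ∈ R, v ∈ t.1) ∧ L.card + R.card = k := by
  rw [isNClique_iff, Finset.card_disjSum, ← and_assoc, ← and_assoc, and_assoc (a := L.card ≤ 1)]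
  refine and_congr_left' ⟨fun h => ⟨Finset.card_le_one.2 fun u hu v hv => ?_,
    fun s hs t ht hst => ?_, fun v hv t ht => ?_⟩, fun ⟨h₁, h₂, h₃⟩ => ?_⟩
  · by_contra huv
    exact h (Finset.inl_mem_disjSum.2 hu) (Finset.inl_mem_disjSum.2 hv) (by simpa using huv)
  · exact (h (Finset.inr_mem_disjSum.2 hs) (Finset.inr_mem_disjSum.2 ht)
      (by simpa using hst)).2
  · exact h (Finset.inl_mem_disjSum.2 hv) (Finset.inr_mem_disjSum.2 ht) (by simp)
  · rintro (u | s) hu (v | t) hv hne <;>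
      simp only [Finset.mem_coe, Finset.inl_mem_disjSum, Finset.inr_mem_disjSum] at hu hv
    · exact hne (congrArg _ (Finset.card_le_one.1 h₁ u hu v hv))
    · exact h₃ u hu t hv
    · exact h₃ v hv s hu
    · have hst : s ≠ t := fun h => hne (congrArg _ h)
      exact ⟨hst, h₂ s hu t hv hst⟩

theorem IsSurface.card_le_two (hG : IsSurface G)
    {R : Finset {t : Finset V // G.IsNClique 3 t}}
    (h : ∀ s ∈ R, ∀ t ∈ R, s ≠ t → (s.1 ∩ t.1).card = 2) : R.card ≤ 2 := by
  by_contra! hR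
  obtain ⟨r, s, t, hr, hs, ht, hrs, hrt, hst⟩ := Finset.two_lt_card_iff.1 hR
  exact hG.not_three_adjacent_triangles r.2 s.2 t.2 (by simpa [Subtype.ext_iff] using hrs)
    (by simpa [Subtype.ext_iff] using hrt) (by simpa [Subtype.ext_iff] using hst)
    (h r hr s hs hrs) (h r hr t ht hrt) (h s hs t ht hst)

variable [Fintype V]

open Classical in
/-- The triangles of `G` containing `e`. -/
noncomputable def trianglesAt (G : SimpleGraph V) (e : Finset V) :
    Finset {t : Finset V // G.IsNClique 3 t} :=
  {t | e ⊆ t.1}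

theorem mem_trianglesAt {e : Finset V} {t : {t : Finset V // G.IsNClique 3 t}} :
    t ∈ trianglesAt G e ↔ e ⊆ t.1 := by
  simp [trianglesAt]

theorem IsSurface.card_trianglesAt (hG : IsSurface G) {e : Finset V} (he : G.IsNClique 2 e) :
    (trianglesAt G e).card = 2 := by
  obtain ⟨t₁, t₂, hne, h⟩ := hG.exists_two_triangles he
  refine Finset.card_eq_two.2 ⟨⟨t₁, ((h t₁).2 (.inl rfl)).1⟩, ⟨t₂, ((h t₂).2 (.inr rfl)).1⟩,
    by simpa using hne, ?_⟩
  ext t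
  simp [mem_trianglesAt, Subtype.ext_iff, ← h, t.2]

theorem inter_eq_of_mem_trianglesAt {e : Finset V}
    (he : G.IsNClique 2 e) {s t : {t : Finset V // G.IsNClique 3 t}} (hst : s ≠ t)
    (hs : s ∈ trianglesAt G e) (ht : t ∈ trianglesAt G e) : s.1 ∩ t.1 = e :=
  inter_eq_of_card_two he.card_eq s.2.card_eq t.2.card_eq (by simpa [Subtype.ext_iff] using hst)
    (mem_trianglesAt.1 hs) (mem_trianglesAt.1 ht)

theorem IsSurface.eq_of_trianglesAt_eq (hG : IsSurface G) {e f : Finset V}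
    (he : G.IsNClique 2 e) (hf : G.IsNClique 2 f) (h : trianglesAt G e = trianglesAt G f) :
    e = f := by
  obtain ⟨s, hs, t, ht, hst⟩ := Finset.one_lt_card.1
    (show 1 < (trianglesAt G e).card by rw [hG.card_trianglesAt he]; decide)
  rw [← inter_eq_of_mem_trianglesAt he hst hs ht,
    inter_eq_of_mem_trianglesAt hf hst (h ▸ hs) (h ▸ ht)]

theorem IsSurface.exists_eq_trianglesAt (hG : IsSurface G)
    {R : Finset {t : Finset V // G.IsNClique 3 t}} (hR : R.card = 2)
    (h : ∀ s ∈ R, ∀ t ∈ R, s ≠ t → (s.1 ∩ t.1).card = 2) :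
    ∃ e, G.IsNClique 2 e ∧ trianglesAt G e = R := by
  obtain ⟨s, t, hst, rfl⟩ := Finset.card_eq_two.1 hR
  have he := isNClique_inter s.2 (h s (by simp) t (by simp) hst)
  refine ⟨s.1 ∩ t.1, he, (Finset.eq_of_subset_of_card_le (fun r hr => ?_) ?_).symm⟩
  · rw [mem_trianglesAt]
    simp only [Finset.mem_insert, Finset.mem_singleton] at hr
    rcases hr with rfl | rfl
    exacts [Finset.inter_subset_left, Finset.inter_subset_right]
  · rw [hG.card_trianglesAt he, hR]

theorem fcount_softModel_one : fcount (softModel G) 1 = fcount G 1 + fcount G 3 := by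
  rw [fcount_one, fcount_one, Nat.card_sum, fcount]

theorem card_sigma_mem (k : ℕ) :
    Nat.card (Σ t : {t : Finset V // G.IsNClique k t}, {v // v ∈ t.1}) = k * fcount G k := by
  classical
  rw [Nat.card_sigma, fcount, Nat.card_eq_fintype_card]
  simp [fun t : {t : Finset V // G.IsNClique k t} => t.2.card_eq, mul_comm]

theorem IsSurface.isNClique_disjSum_trianglesAt (hG : IsSurface G) {e : Finset V}
    (he : G.IsNClique 2 e) {L : Finset V} (hL : L.card ≤ 1) (hLe : L ⊆ e) :
    (softModel G).IsNClique (L.card + 2) (L.disjSum (trianglesAt G e)) := by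
  refine softModel_isNClique_disjSum.2 ⟨hL, fun s hs t ht hst => ?_, fun v hv t ht =>
    mem_trianglesAt.1 ht (hLe hv), by rw [hG.card_trianglesAt he]⟩
  rw [inter_eq_of_mem_trianglesAt he hst hs ht, he.card_eq]

theorem IsSurface.fcount_softModel_two (hG : IsSurface G) :
    fcount (softModel G) 2 = fcount G 2 + 3 * fcount G 3 := by
  rw [← card_sigma_mem, fcount, fcount, ← Nat.card_sum]
  refine (Nat.card_congr (Equiv.ofBijective (fun x => match x with
    | .inl e => ⟨(∅ : Finset V).disjSum (trianglesAt G e.1),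
        hG.isNClique_disjSum_trianglesAt e.2 (L := ∅) (by simp) (by simp)⟩
    | .inr p => ⟨({p.2.1} : Finset V).disjSum {p.1}, softModel_isNClique_disjSum.2
        ⟨by simp, by simp, by simp, by simp⟩⟩) ⟨?_, ?_⟩)).symm
  · rintro (⟨e, he⟩ | ⟨t, v, hv⟩) (⟨f, hf⟩ | ⟨t', v', hv'⟩) h <;>
      have hL := congrArg (fun s => s.1.toLeft) h <;>
      have hR := congrArg (fun s => s.1.toRight) h <;>
      simp only [Finset.toLeft_disjSum, Finset.toRight_disjSum, Finset.singleton_inj] at hL hR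
    · simpa using hG.eq_of_trianglesAt_eq he hf hR
    · simp at hL
    · simp at hL
    · subst hL hR
      rfl
  · rintro ⟨s, hs⟩
    rw [← Finset.toLeft_disjSum_toRight (u := s)] at hs
    obtain ⟨h₁, h₂, h₃, h₄⟩ := softModel_isNClique_disjSum.1 hs
    obtain h | h : s.toLeft.card = 0 ∨ s.toLeft.card = 1 := by omega
    · obtain ⟨e, he, heR⟩ := hG.exists_eq_trianglesAt (by omega) h₂
      refine ⟨.inl ⟨e, he⟩, Subtype.ext ?_⟩
      simp only
      rw [heR, ← Finset.card_eq_zero.1 h, Finset.toLeft_disjSum_toRight]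
    · obtain ⟨v, hv⟩ := Finset.card_eq_one.1 h
      obtain ⟨t, ht⟩ := Finset.card_eq_one.1 (show s.toRight.card = 1 by omega)
      refine ⟨.inr ⟨t, v, h₃ v (by simp [hv]) t (by simp [ht])⟩, Subtype.ext ?_⟩
      simp only
      rw [← hv, ← ht, Finset.toLeft_disjSum_toRight]

theorem IsSurface.fcount_softModel_three (hG : IsSurface G) :
    fcount (softModel G) 3 = 2 * fcount G 2 := by
  rw [← card_sigma_mem, fcount]
  refine (Nat.card_congr (Equiv.ofBijective (fun p =>
    ⟨({p.2.1} : Finset V).disjSum (trianglesAt G p.1.1),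
      hG.isNClique_disjSum_trianglesAt p.1.2 (L := {p.2.1}) (by simp) (by simp)⟩) ⟨?_, ?_⟩)).symm
  · rintro ⟨⟨e, he⟩, v, hv⟩ ⟨⟨f, hf⟩, v', hv'⟩ h
    have hL := congrArg (fun s => s.1.toLeft) h
    have hR := congrArg (fun s => s.1.toRight) h
    simp only [Finset.toLeft_disjSum, Finset.toRight_disjSum, Finset.singleton_inj] at hL hR
    obtain rfl := hG.eq_of_trianglesAt_eq he hf hR
    subst hL
    rfl
  · rintro ⟨s, hs⟩
    rw [← Finset.toLeft_disjSum_toRight (u := s)] at hs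
    obtain ⟨h₁, h₂, h₃, h₄⟩ := softModel_isNClique_disjSum.1 hs
    have h₅ := hG.card_le_two h₂
    obtain ⟨v, hv⟩ := Finset.card_eq_one.1 (show s.toLeft.card = 1 by omega)
    obtain ⟨e, he, heR⟩ := hG.exists_eq_trianglesAt (by omega) h₂
    obtain ⟨t₁, t₂, ht, hR⟩ := Finset.card_eq_two.1 (show s.toRight.card = 2 by omega)
    have hve : v ∈ e := by
      rw [← inter_eq_of_mem_trianglesAt he ht (by simp [heR, hR])
        (by simp [heR, hR]), Finset.mem_inter]
      exact ⟨h₃ v (by simp [hv]) t₁ (by simp [hR]), h₃ v (by simp [hv]) t₂ (by simp [hR])⟩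
    refine ⟨⟨⟨e, he⟩, v, hve⟩, Subtype.ext ?_⟩
    simp only
    rw [heR, ← hv, Finset.toLeft_disjSum_toRight]

theorem IsSurface.two_mul_fcount_two (hG : IsSurface G) :
    2 * fcount G 2 = 3 * fcount G 3 := by
  classical
  rw [fcount, fcount, Nat.card_eq_fintype_card, Nat.card_eq_fintype_card, mul_comm 2, mul_comm 3,
    ← Finset.card_univ, ← Finset.card_univ]
  refine Finset.card_mul_eq_card_mul (fun (e : {e // G.IsNClique 2 e})
    (t : {t // G.IsNClique 3 t}) => e.1 ⊆ t.1) (fun e _ => ?_) (fun t _ => ?_)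
  · refine Eq.trans (congrArg Finset.card ?_) (hG.card_trianglesAt e.2)
    ext t
    simp [Finset.mem_bipartiteAbove, mem_trianglesAt]
  · have h : (Finset.powersetCard 2 t.1).card = 3 := by
      rw [Finset.card_powersetCard, t.2.card_eq]
      rfl
    refine Eq.trans (Finset.card_bij (fun e _ => e.1) (fun e he => ?_) (fun _ _ _ _ => Subtype.ext)
      fun e he => ?_) h
    · exact Finset.mem_powersetCard.2 ⟨(Finset.mem_bipartiteBelow _).1 he |>.2, e.2.card_eq⟩
    · obtain ⟨hsub, hcard⟩ := Finset.mem_powersetCard.1 he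
      exact ⟨⟨e, t.2.isClique.subset (by simpa using hsub), hcard⟩,
        (Finset.mem_bipartiteBelow _).2 ⟨Finset.mem_univ _, hsub⟩, rfl⟩

end Counting

theorem stmt16 {V : Type} [Fintype V] (G : SimpleGraph V) (hG : IsGraphManifold 2 G) :
    fcount (softBary G 2) 1 = fcount G 1 + fcount G 3 ∧
    fcount (softBary G 2) 2 = fcount G 2 + 3 * fcount G 3 ∧
    fcount (softBary G 2) 3 = 3 * fcount G 3 ∧
    (fcount (softBary G 2) 1 : ℤ) - fcount (softBary G 2) 2 + fcount (softBary G 2) 3 =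
      (fcount G 1 : ℤ) - fcount G 2 + fcount G 3 := by
  classical
  have hS : IsSurface G := fun u v => hG.exists_common_neighbors
  have h₁ := fcount_softModel_one (G := G)
  have h₂ := hS.fcount_softModel_two
  have h₃ := hS.fcount_softModel_three
  have h₄ := hS.two_mul_fcount_two
  simp only [fcount_congr (softModelIso hS)] at h₁ h₂ h₃
  omega
end
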